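/- arXiv:1408.1434 — 7 statements merged into one kernel-verified Lean document; each statement's English description precedes it below -/
import Mathlib

section
/- For every initial value R₀ ∈ ℝ and all parameter values T > 0, α > 0, β > 0, c > 0, u₁ > 0, there exists an admissible control û (a measurable function û : [0,T] → ℝ with 0 ≤ û(t) ≤ u₁ a.e.) that minimizes the cost J(u) = ∫₀ᵀ (α (Ku)(t) + β u(t)) dt over all admissible controls, where (Ku)(t) = R₀ exp(−∫₀ᵗ u(ξ)dξ) + c ∫₀ᵗ exp(−∫ₛᵗ u(ξ)dξ) ds. -/
open MeasureTheory Real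

/-- An admissible control: measurable, with values in `[0, u₁]` a.e. on `[0, T]`. -/
def Admissible (T u₁ : ℝ) (u : ℝ → ℝ) : Prop :=
  Measurable u ∧ ∀ᵐ t ∂(volume.restrict (Set.Icc (0:ℝ) T)), u t ∈ Set.Icc (0:ℝ) u₁

/-- The state `(Ku)(t) = R₀ exp(−∫₀ᵗ u) + c ∫₀ᵗ exp(−∫ₛᵗ u) ds`. -/
noncomputable def Kstate (R₀ c : ℝ) (u : ℝ → ℝ) (t : ℝ) : ℝ :=
  R₀ * Real.exp (-(∫ ξ in (0:ℝ)..t, u ξ)) +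
    c * ∫ s in (0:ℝ)..t, Real.exp (-(∫ ξ in s..t, u ξ))

/-- The cost `J(u) = ∫₀ᵀ (α (Ku)(t) + β u(t)) dt`. -/
noncomputable def Jcost (α β c T R₀ : ℝ) (u : ℝ → ℝ) : ℝ :=
  ∫ t in (0:ℝ)..T, (α * Kstate R₀ c u t + β * u t)

open scoped NNReal

/-- Continuous functions vanishing at `0` whose increments over `[x, y]` lie in
`[0, k * (y - x)]`: the cumulative controls. -/
def cumulativeControls (k : ℝ≥0) : Set C(ℝ, ℝ) :=
  {f | f 0 = 0 ∧ ∀ x y, x ≤ y → f y - f x ∈ Set.Icc (0:ℝ) (k * (y - x))}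

lemma lipschitzWith_of_sub_mem_Icc {k : ℝ≥0} {f : ℝ → ℝ}
    (hf : ∀ x y, x ≤ y → f y - f x ∈ Set.Icc (0:ℝ) (k * (y - x))) : LipschitzWith k f := by
  refine LipschitzWith.of_dist_le_mul fun x y => ?_
  rw [Real.dist_eq, Real.dist_eq]
  rcases le_total x y with h | h
  · rw [abs_sub_comm, abs_sub_comm x y, abs_of_nonneg (hf x y h).1, abs_of_nonneg (sub_nonneg.2 h)]
    exact (hf x y h).2
  · rw [abs_of_nonneg (hf y x h).1, abs_of_nonneg (sub_nonneg.2 h)]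
    exact (hf y x h).2

lemma isCompact_cumulativeControls (k : ℝ≥0) : IsCompact (cumulativeControls k) := by
  refine ArzelaAscoli.isCompact_of_equicontinuous _ ?_ ?_
  · have himage : ContinuousMap.toFun '' cumulativeControls k =
        {g : ℝ → ℝ | g 0 = 0 ∧ ∀ x y, x ≤ y → g y - g x ∈ Set.Icc (0:ℝ) (k * (y - x))} := by
      ext g
      constructor
      · rintro ⟨f, hf, rfl⟩
        exact hf
      · intro hg
        exact ⟨⟨g, (lipschitzWith_of_sub_mem_Icc hg.2).continuous⟩, hg, rfl⟩
    rw [himage]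
    refine (isCompact_univ_pi fun t : ℝ =>
      isCompact_Icc (a := -(k * |t|)) (b := k * |t|)).of_isClosed_subset ?_ ?_
    · refine (isClosed_eq (continuous_apply 0) continuous_const).and ?_
      simp only [Set.ofPred_forall]
      exact isClosed_iInter fun x => isClosed_iInter fun y => isClosed_iInter fun _ =>
        isClosed_Icc.preimage ((continuous_apply y).sub (continuous_apply x))
    · rintro g ⟨hg0, hg⟩ t -
      have h := (lipschitzWith_of_sub_mem_Icc hg).dist_le_mul t 0
      rw [hg0, Real.dist_eq, Real.dist_eq, sub_zero, sub_zero] at h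
      exact abs_le.1 h
  · exact (LipschitzWith.uniformEquicontinuous _ k fun f =>
      lipschitzWith_of_sub_mem_Icc f.2.2).equicontinuous

/-- The state as a function of the cumulative control. -/
noncomputable def cumulativeState (R₀ c : ℝ) (f : C(ℝ, ℝ)) (t : ℝ) : ℝ :=
  R₀ * Real.exp (-f t) + c * ∫ s in (0:ℝ)..t, Real.exp (-(f t - f s))

lemma continuous_uncurry_cumulativeState (R₀ c : ℝ) :
    Continuous (Function.uncurry (cumulativeState R₀ c)) := by
  have heval : Continuous fun p : C(ℝ, ℝ) × ℝ => p.1 p.2 := continuous_eval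
  have hint : Continuous fun p : C(ℝ, ℝ) × ℝ =>
      ∫ s in (0:ℝ)..p.2, Real.exp (-(p.1 p.2 - p.1 s)) := by
    refine intervalIntegral.continuous_parametric_intervalIntegral_of_continuous
      (f := fun (p : C(ℝ, ℝ) × ℝ) s => Real.exp (-(p.1 p.2 - p.1 s))) ?_ continuous_snd
    exact Real.continuous_exp.comp ((heval.comp continuous_fst).sub
      (heval.comp ((continuous_fst.comp continuous_fst).prodMk continuous_snd))).neg
  exact (continuous_const.mul (Real.continuous_exp.comp heval.neg)).add (continuous_const.mul hint)

/-- The cost as a function of the cumulative control. -/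
noncomputable def cumulativeCost (α β c T R₀ : ℝ) (f : C(ℝ, ℝ)) : ℝ :=
  (∫ t in (0:ℝ)..T, α * cumulativeState R₀ c f t) + β * f T

lemma continuous_cumulativeCost (α β c T R₀ : ℝ) :
    Continuous (cumulativeCost α β c T R₀) := by
  refine Continuous.add ?_ (continuous_const.mul (continuous_eval_const T))
  exact intervalIntegral.continuous_parametric_intervalIntegral_of_continuous'
    (f := fun f t => α * cumulativeState R₀ c f t)
    (continuous_const.mul (continuous_uncurry_cumulativeState R₀ c)) 0 T

lemma Jcost_eq_cumulativeCost {α β c T R₀ : ℝ} (hT : 0 ≤ T) {u : ℝ → ℝ} {f : C(ℝ, ℝ)}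
    (hu : IntervalIntegrable u volume 0 T)
    (huf : ∀ t ∈ Set.Icc (0:ℝ) T, ∫ ξ in (0:ℝ)..t, u ξ = f t) :
    Jcost α β c T R₀ u = cumulativeCost α β c T R₀ f := by
  have hsub : ∀ t ∈ Set.Icc (0:ℝ) T, IntervalIntegrable u volume 0 t := fun t ht =>
    hu.mono_set (by
      rw [Set.uIcc_of_le ht.1, Set.uIcc_of_le hT]
      exact Set.Icc_subset_Icc_right ht.2)
  have hstate : ∀ t ∈ Set.Icc (0:ℝ) T, Kstate R₀ c u t = cumulativeState R₀ c f t := by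
    intro t ht
    have hinner : ∫ s in (0:ℝ)..t, Real.exp (-(∫ ξ in s..t, u ξ)) =
        ∫ s in (0:ℝ)..t, Real.exp (-(f t - f s)) := by
      refine intervalIntegral.integral_congr fun s hs => ?_
      rw [Set.uIcc_of_le ht.1] at hs
      have hs' : s ∈ Set.Icc (0:ℝ) T := ⟨hs.1, hs.2.trans ht.2⟩
      rw [← huf t ht, ← huf s hs',
        intervalIntegral.integral_interval_sub_left (hsub t ht) (hsub s hs')]
    rw [Kstate, cumulativeState, hinner, huf t ht]
  have hcont : Continuous (cumulativeState R₀ c f) :=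
    (continuous_uncurry_cumulativeState R₀ c).uncurry_left f
  calc Jcost α β c T R₀ u
      = ∫ t in (0:ℝ)..T, (α * cumulativeState R₀ c f t + β * u t) := by
        refine intervalIntegral.integral_congr fun t ht => ?_
        rw [Set.uIcc_of_le hT] at ht
        simp only [hstate t ht]
    _ = cumulativeCost α β c T R₀ f := by
        rw [intervalIntegral.integral_add ((hcont.const_mul α).intervalIntegrable _ _)
          (hu.const_mul β), intervalIntegral.integral_const_mul β,
          huf T (Set.right_mem_Icc.2 hT), cumulativeCost]

lemma exists_admissible_of_mem_cumulativeControls {k : ℝ≥0} {f : C(ℝ, ℝ)}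
    (hf : f ∈ cumulativeControls k) (T : ℝ) :
    ∃ u, Admissible T k u ∧ IntervalIntegrable u volume 0 T ∧
      ∀ t, ∫ ξ in (0:ℝ)..t, u ξ = f t := by
  have hlip : LipschitzWith k f := lipschitzWith_of_sub_mem_Icc hf.2
  have hmono : Monotone f := fun x y h => sub_nonneg.1 (hf.2 x y h).1
  have hac : ∀ t, AbsolutelyContinuousOnInterval f 0 t := fun t =>
    hlip.lipschitzOnWith.absolutelyContinuousOnInterval
  refine ⟨deriv f, ⟨measurable_deriv f, .of_forall fun t => ⟨hmono.deriv_nonneg,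
    (le_abs_self _).trans (norm_deriv_le_of_lipschitz hlip)⟩⟩,
    (hac T).intervalIntegrable_deriv, fun t => ?_⟩
  rw [(hac t).integral_deriv_eq_sub, hf.1, sub_zero]

lemma Admissible.exists_mem_cumulativeControls {k : ℝ≥0} {T : ℝ} {u : ℝ → ℝ}
    (hu : Admissible T k u) (hT : 0 ≤ T) :
    IntervalIntegrable u volume 0 T ∧
      ∃ f ∈ cumulativeControls k, ∀ t ∈ Set.Icc (0:ℝ) T, ∫ ξ in (0:ℝ)..t, u ξ = f t := by
  set v : ℝ → ℝ := fun t => max 0 (min (k : ℝ) (u t)) with hv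
  have hv_mem : ∀ t, v t ∈ Set.Icc 0 (k : ℝ) := fun t =>
    ⟨le_max_left _ _, max_le k.2 (min_le_left _ _)⟩
  have hv_meas : Measurable v := measurable_const.max (measurable_const.min hu.1)
  have hv_int : ∀ a b, IntervalIntegrable v volume a b := fun a b =>
    (intervalIntegrable_const (c := (k : ℝ))).mono_fun hv_meas.aestronglyMeasurable
      (.of_forall fun t => by
        simp only
        rw [Real.norm_of_nonneg (hv_mem t).1]
        exact (hv_mem t).2.trans (le_abs_self _))
  have hvu : ∀ᵐ t ∂volume, t ∈ Set.Icc (0:ℝ) T → v t = u t := by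
    filter_upwards [(ae_restrict_iff' measurableSet_Icc).1 hu.2] with t ht htT
    simp only [hv, min_eq_right (ht htT).2, max_eq_right (ht htT).1]
  have hvu_sub : ∀ t ∈ Set.Icc (0:ℝ) T, ∀ᵐ x ∂volume, x ∈ Set.uIoc 0 t → v x = u x := by
    intro t ht
    filter_upwards [hvu] with x hx hxt
    rw [Set.uIoc_of_le ht.1] at hxt
    exact hx ⟨hxt.1.le, hxt.2.trans ht.2⟩
  refine ⟨(hv_int 0 T).congr_ae ((ae_restrict_iff' measurableSet_uIoc).2
    (hvu_sub T (Set.right_mem_Icc.2 hT))), ?_⟩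
  refine ⟨⟨fun t => ∫ ξ in (0:ℝ)..t, v ξ, intervalIntegral.continuous_primitive hv_int 0⟩,
    ⟨by simp, fun x y hxy => ?_⟩, fun t ht =>
      (intervalIntegral.integral_congr_ae (hvu_sub t ht)).symm⟩
  simp only [ContinuousMap.coe_mk]
  rw [intervalIntegral.integral_interval_sub_left (hv_int 0 y) (hv_int 0 x)]
  refine ⟨intervalIntegral.integral_nonneg hxy fun t _ => (hv_mem t).1, ?_⟩
  calc ∫ t in x..y, v t ≤ ∫ _ in x..y, (k : ℝ) :=
        intervalIntegral.integral_mono_on hxy (hv_int x y) intervalIntegrable_const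
          fun t _ => (hv_mem t).2
    _ = k * (y - x) := by rw [intervalIntegral.integral_const, smul_eq_mul, mul_comm]

/-- existence of an optimal admissible control. -/
theorem exists_optimal_control (α β c u₁ T R₀ : ℝ)
    (hα : 0 < α) (hβ : 0 < β) (hc : 0 < c) (hu₁ : 0 < u₁) (hT : 0 < T) :
    ∃ uo : ℝ → ℝ, Admissible T u₁ uo ∧
      ∀ u : ℝ → ℝ, Admissible T u₁ u → Jcost α β c T R₀ uo ≤ Jcost α β c T R₀ u := by
  lift u₁ to ℝ≥0 using hu₁.le
  have hne : (cumulativeControls u₁).Nonempty :=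
    ⟨0, rfl, fun x y h => by simpa using mul_nonneg u₁.2 (sub_nonneg.2 h)⟩
  obtain ⟨f, hf, hmin⟩ := (isCompact_cumulativeControls u₁).exists_isMinOn hne
    (continuous_cumulativeCost α β c T R₀).continuousOn
  obtain ⟨uo, hadm, hint, huo⟩ := exists_admissible_of_mem_cumulativeControls hf T
  refine ⟨uo, hadm, fun u hu => ?_⟩
  obtain ⟨hu_int, g, hg, hug⟩ := hu.exists_mem_cumulativeControls hT.le
  rw [Jcost_eq_cumulativeCost hT.le hint fun t _ => huo t,
    Jcost_eq_cumulativeCost hT.le hu_int hug]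
  exact hmin hg
end

section
/- Let (u⁽ⁿ⁾) be a sequence of admissible controls and û an admissible control such that for every ρ ∈ L¹[0,T] one has ∫₀ᵀ ρ(ξ) u⁽ⁿ⁾(ξ) dξ → ∫₀ᵀ ρ(ξ) û(ξ) dξ as n → ∞ (weak-* convergence in L∞[0,T]). Then the corresponding states converge pointwise: for every t ∈ [0,T], (Ku⁽ⁿ⁾)(t) → (Kû)(t) as n → ∞. -/
open MeasureTheory Real

lemma Admissible.integrableOn {T u₁ : ℝ} {u : ℝ → ℝ} (hu : Admissible T u₁ u) :
    IntegrableOn u (Set.Icc 0 T) := by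
  refine Measure.integrableOn_of_bounded (M := u₁) (by simp) hu.1.aestronglyMeasurable ?_
  filter_upwards [hu.2] with x hx
  rw [Real.norm_eq_abs, abs_of_nonneg hx.1]
  exact hx.2

lemma Admissible.intervalIntegral_nonneg {T u₁ : ℝ} {u : ℝ → ℝ} (hu : Admissible T u₁ u)
    {s t : ℝ} (hs : 0 ≤ s) (hst : s ≤ t) (ht : t ≤ T) : 0 ≤ ∫ ξ in s..t, u ξ := by
  refine intervalIntegral.integral_nonneg_of_ae_restrict hst ?_
  filter_upwards [ae_restrict_of_ae_restrict_of_subset (Set.Icc_subset_Icc hs ht) hu.2] with x hx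
  exact hx.1

lemma intervalIntegral_indicator_Ioc_mul {T s t : ℝ} (hs : 0 ≤ s) (hst : s ≤ t) (ht : t ≤ T)
    (u : ℝ → ℝ) :
    ∫ ξ in (0:ℝ)..T, (Set.Ioc s t).indicator 1 ξ * u ξ = ∫ ξ in s..t, u ξ := by
  have h : (fun ξ => (Set.Ioc s t).indicator 1 ξ * u ξ) = (Set.Ioc s t).indicator u := by
    ext ξ
    by_cases hξ : ξ ∈ Set.Ioc s t <;> simp [hξ]
  rw [h, intervalIntegral.integral_of_le (hs.trans (hst.trans ht)),
    setIntegral_indicator measurableSet_Ioc, intervalIntegral.integral_of_le hst,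
    Set.inter_eq_self_of_subset_right (Set.Ioc_subset_Ioc hs ht)]

open Filter in
/-- weak-* convergence of admissible controls (tested against every
`ρ ∈ L¹[0,T]`) implies pointwise convergence of the corresponding states. -/
theorem Kstate_tendsto_of_weakStar (c u₁ T R₀ : ℝ)
    (hc : 0 < c) (hu₁ : 0 < u₁) (hT : 0 < T)
    (uN : ℕ → ℝ → ℝ) (huN : ∀ n, Admissible T u₁ (uN n))
    (uo : ℝ → ℝ) (huo : Admissible T u₁ uo)
    (hweak : ∀ ρ : ℝ → ℝ, IntegrableOn ρ (Set.Icc (0:ℝ) T) →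
      Tendsto (fun n => ∫ ξ in (0:ℝ)..T, ρ ξ * uN n ξ) atTop
        (nhds (∫ ξ in (0:ℝ)..T, ρ ξ * uo ξ))) :
    ∀ t ∈ Set.Icc (0:ℝ) T,
      Tendsto (fun n => Kstate R₀ c (uN n) t) atTop (nhds (Kstate R₀ c uo t)) := by
  intro t ht
  have hexp : ∀ s, 0 ≤ s → s ≤ t → Tendsto (fun n => Real.exp (-(∫ ξ in s..t, uN n ξ))) atTop
      (nhds (Real.exp (-(∫ ξ in s..t, uo ξ)))) := by
    intro s hs hst
    have h := hweak ((Set.Ioc s t).indicator 1)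
      ((integrableOn_const (by simp)).indicator measurableSet_Ioc)
    simp only [intervalIntegral_indicator_Ioc_mul hs hst ht.2] at h
    exact (Real.continuous_exp.tendsto _).comp h.neg
  refine ((hexp 0 le_rfl ht.1).const_mul R₀).add (Tendsto.const_mul c ?_)
  refine intervalIntegral.tendsto_integral_filter_of_dominated_convergence (fun _ => 1)
    (Eventually.of_forall fun n => ?_) (Eventually.of_forall fun n => ae_of_all _ fun s hs => ?_)
    intervalIntegrable_const (ae_of_all _ fun s hs => ?_)
  · have hcont : ContinuousOn (fun s => ∫ ξ in s..t, uN n ξ) (Set.uIcc 0 t) :=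
      intervalIntegral.continuousOn_primitive_interval_left <| by
        rw [Set.uIcc_of_le ht.1]
        exact (huN n).integrableOn.mono_set (Set.Icc_subset_Icc_right ht.2)
    exact ((Real.continuous_exp.comp_continuousOn hcont.neg).mono
      Set.uIoc_subset_uIcc).aestronglyMeasurable measurableSet_uIoc
  · rw [Set.uIoc_of_le ht.1] at hs
    rw [Real.norm_eq_abs, Real.abs_exp, Real.exp_le_one_iff, neg_nonpos]
    exact (huN n).intervalIntegral_nonneg hs.1.le hs.2 ht.2
  · rw [Set.uIoc_of_le ht.1] at hs
    exact hexp s hs.1.le hs.2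
end

section
/- (Singular extremal, Lemma 2.) Suppose √(αc/β) ≤ u₁ and set u_s = √(αc/β). Then the constant functions R_s(t) ≡ √(cβ/α) and ψ_s(t) ≡ −√(αβ/c) solve the Hamiltonian system ψ′ = α + u_s ψ, R′ = −u_s R + c on [0,T], the control satisfies 0 ≤ u_s ≤ u₁, and the switching function vanishes identically along this trajectory: H₁(R_s(t), ψ_s(t)) = −β − R_s(t) ψ_s(t) = 0 for all t. -/
open MeasureTheory Real

/-- If `x * y = z ^ 2` with `x, z ≥ 0`, then `√x * √y = z`. -/
theorem sqrt_mul_sqrt_eq_of_mul_eq_sq {x y z : ℝ} (hx : 0 ≤ x) (hz : 0 ≤ z)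
    (h : x * y = z ^ 2) : Real.sqrt x * Real.sqrt y = z := by
  rw [← Real.sqrt_mul hx, h, Real.sqrt_sq hz]

/-- Lemma 2: if `√(αc/β) ≤ u₁`, the constants
`R_s ≡ √(cβ/α)`, `ψ_s ≡ −√(αβ/c)` solve the Hamiltonian system with the singular
control `u_s = √(αc/β)`, which is admissible, and the switching function
`H₁(R, ψ) = −β − Rψ` vanishes identically along this trajectory. -/
theorem singular_extremal (α β c u₁ T : ℝ)
    (hα : 0 < α) (hβ : 0 < β) (hc : 0 < c) (hu₁ : 0 < u₁) (hT : 0 < T)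
    (hsing : Real.sqrt (α * c / β) ≤ u₁) :
    (∀ t : ℝ, HasDerivAt (fun _ : ℝ => -Real.sqrt (α * β / c))
        (α + Real.sqrt (α * c / β) * (-Real.sqrt (α * β / c))) t) ∧
    (∀ t : ℝ, HasDerivAt (fun _ : ℝ => Real.sqrt (c * β / α))
        (-(Real.sqrt (α * c / β)) * Real.sqrt (c * β / α) + c) t) ∧
    (0 ≤ Real.sqrt (α * c / β) ∧ Real.sqrt (α * c / β) ≤ u₁) ∧
    (∀ _t : ℝ, -β - Real.sqrt (c * β / α) * (-Real.sqrt (α * β / c)) = 0) := by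
  have h₁ : Real.sqrt (α * c / β) * Real.sqrt (α * β / c) = α :=
    sqrt_mul_sqrt_eq_of_mul_eq_sq (by positivity) hα.le (by field_simp)
  have h₂ : Real.sqrt (α * c / β) * Real.sqrt (c * β / α) = c :=
    sqrt_mul_sqrt_eq_of_mul_eq_sq (by positivity) hc.le (by field_simp)
  have h₃ : Real.sqrt (c * β / α) * Real.sqrt (α * β / c) = β :=
    sqrt_mul_sqrt_eq_of_mul_eq_sq (by positivity) hβ.le (by field_simp)
  refine ⟨fun t => ?_, fun t => ?_, ⟨Real.sqrt_nonneg _, hsing⟩, fun _ => ?_⟩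
  · rw [mul_neg, h₁, add_neg_cancel]
    exact hasDerivAt_const t _
  · rw [neg_mul, h₂, neg_add_cancel]
    exact hasDerivAt_const t _
  · rw [mul_neg, h₃, sub_neg_eq_add, neg_add_cancel]
end

section
/- (Characterization of singular arcs.) Let u be a measurable control with 0 ≤ u(t) ≤ u₁ a.e., and let R, ψ : (t₁,t₂) → ℝ be absolutely continuous functions with R > 0 solving the Hamiltonian system ψ′(t) = α + u(t) ψ(t), R′(t) = −u(t) R(t) + c for a.e. t ∈ (t₁,t₂). If the switching function vanishes identically, −β − R(t) ψ(t) = 0 for all t ∈ (t₁,t₂), then necessarily R(t) = √(cβ/α) and ψ(t) = −√(αβ/c) for all t ∈ (t₁,t₂), and u(t) = √(αc/β) for almost every t ∈ (t₁,t₂). -/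
open MeasureTheory Real

/-- characterization of singular arcs.  If `R, ψ` are (absolutely)
continuous on `(t₁,t₂)`, `R > 0`, they solve the Hamiltonian system a.e. for an
admissible control `u`, and the switching function `−β − Rψ` vanishes identically on
`(t₁,t₂)`, then `R ≡ √(cβ/α)`, `ψ ≡ −√(αβ/c)`, and `u = √(αc/β)` a.e. on `(t₁,t₂)`. -/
theorem singular_arc_characterization (α β c u₁ t₁ t₂ : ℝ)
    (hα : 0 < α) (hβ : 0 < β) (hc : 0 < c) (hu₁ : 0 < u₁) (ht : t₁ < t₂)
    (u : ℝ → ℝ) (hu_meas : Measurable u)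
    (hu_bd : ∀ᵐ t ∂(volume.restrict (Set.Ioo t₁ t₂)), u t ∈ Set.Icc (0:ℝ) u₁)
    (R ψ : ℝ → ℝ)
    (hRcont : ContinuousOn R (Set.Ioo t₁ t₂)) (hψcont : ContinuousOn ψ (Set.Ioo t₁ t₂))
    (hRpos : ∀ t ∈ Set.Ioo t₁ t₂, 0 < R t)
    (hode : ∀ᵐ t ∂(volume.restrict (Set.Ioo t₁ t₂)),
      HasDerivAt ψ (α + u t * ψ t) t ∧ HasDerivAt R (-(u t) * R t + c) t)
    (hsw : ∀ t ∈ Set.Ioo t₁ t₂, -β - R t * ψ t = 0) :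
    (∀ t ∈ Set.Ioo t₁ t₂, R t = Real.sqrt (c * β / α)) ∧
    (∀ t ∈ Set.Ioo t₁ t₂, ψ t = -Real.sqrt (α * β / c)) ∧
    (∀ᵐ t ∂(volume.restrict (Set.Ioo t₁ t₂)), u t = Real.sqrt (α * c / β)) := by
  have hR_ae : R =ᵐ[volume.restrict (Set.Ioo t₁ t₂)] fun _ => √(c * β / α) := by
    filter_upwards [hode, ae_restrict_mem measurableSet_Ioo] with t ⟨hψ', hR'⟩ htI
    have hconst : HasDerivAt (fun s => R s * ψ s) 0 t := by
      refine (hasDerivAt_const t (-β)).congr_of_eventuallyEq ?_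
      filter_upwards [Ioo_mem_nhds htI.1 htI.2] with s hs
      linarith [hsw s hs]
    have hzero := (hR'.mul hψ').unique hconst
    have hprod := hsw t htI
    refine (Real.sqrt_eq_iff_mul_self_eq (by positivity) (hRpos t htI).le).2 ?_ |>.symm
    rw [div_eq_iff hα.ne']
    linear_combination (-c) * hprod - R t * hzero
  have hR : ∀ t ∈ Set.Ioo t₁ t₂, R t = √(c * β / α) :=
    Measure.eqOn_open_of_ae_eq hR_ae isOpen_Ioo hRcont continuousOn_const
  have hpos : 0 < √(c * β / α) := Real.sqrt_pos.2 (by positivity)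
  refine ⟨hR, fun t htI => ?_, ?_⟩
  · have hprod := hsw t htI
    rw [hR t htI] at hprod
    have hmul : √(c * β / α) * √(α * β / c) = β := by
      rw [← Real.sqrt_mul (by positivity), show c * β / α * (α * β / c) = β ^ 2 by field_simp,
        Real.sqrt_sq hβ.le]
    apply mul_left_cancel₀ hpos.ne'
    linarith
  · filter_upwards [hode, ae_restrict_mem measurableSet_Ioo] with t ⟨_, hR'⟩ htI
    have hconst : HasDerivAt R 0 t := by
      refine (hasDerivAt_const t (√(c * β / α))).congr_of_eventuallyEq ?_
      filter_upwards [Ioo_mem_nhds htI.1 htI.2] with s hs using hR s hs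
    have hzero := hR'.unique hconst
    rw [hR t htI] at hzero
    have hmul : √(c * β / α) * √(α * c / β) = c := by
      rw [← Real.sqrt_mul (by positivity), show c * β / α * (α * c / β) = c ^ 2 by field_simp,
        Real.sqrt_sq hc.le]
    apply mul_left_cancel₀ hpos.ne'
    linarith
end

section
/- (Theorem 1, structure of optimal control in the nonsingular case.) Suppose √(αc/β) > u₁ and R₀ ≥ 0. Let û be an admissible control minimizing J. Then there exist times 0 ≤ t₁ ≤ t₂ ≤ T such that û(t) = 0 for almost every t ∈ (0, t₁), û(t) = u₁ for almost every t ∈ (t₁, t₂), and û(t) = 0 for almost every t ∈ (t₂, T). In particular, the optimal control takes only the two values 0 and u₁ (a.e.) and switches between them at most twice. -/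
open MeasureTheory Real

section

open Set Filter Topology

/-- The state multiplied by its integrating factor, `R₀ + c ∫₀ᵗ exp U`. -/
noncomputable def stateFactor (R₀ c : ℝ) (U : ℝ → ℝ) (t : ℝ) : ℝ :=
  R₀ + c * ∫ s in (0:ℝ)..t, exp (U s)

/-- The adjoint variable divided by its integrating factor, `∫ₜᵀ exp (-U)`. -/
noncomputable def adjointFactor (T : ℝ) (U : ℝ → ℝ) (t : ℝ) : ℝ :=
  ∫ s in t..T, exp (-U s)

lemma hasDerivAt_stateFactor (R₀ c : ℝ) {U : ℝ → ℝ} (hU : Continuous U) (t : ℝ) :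
    HasDerivAt (stateFactor R₀ c U) (c * exp (U t)) t := by
  have h : Continuous fun s => exp (U s) := by fun_prop
  exact ((h.integral_hasStrictDerivAt 0 t).hasDerivAt.const_mul c).const_add R₀

lemma hasDerivAt_adjointFactor (T : ℝ) {U : ℝ → ℝ} (hU : Continuous U) (t : ℝ) :
    HasDerivAt (adjointFactor T U) (-exp (-U t)) t := by
  have h : Continuous fun s => exp (-U s) := by fun_prop
  exact intervalIntegral.integral_hasDerivAt_left (h.intervalIntegrable _ _)
    h.stronglyMeasurable.stronglyMeasurableAtFilter h.continuousAt

lemma continuous_stateFactor (R₀ c : ℝ) {U : ℝ → ℝ} (hU : Continuous U) :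
    Continuous (stateFactor R₀ c U) :=
  continuous_iff_continuousAt.2 fun t => (hasDerivAt_stateFactor R₀ c hU t).continuousAt

lemma continuous_adjointFactor (T : ℝ) {U : ℝ → ℝ} (hU : Continuous U) :
    Continuous (adjointFactor T U) :=
  continuous_iff_continuousAt.2 fun t => (hasDerivAt_adjointFactor T hU t).continuousAt

lemma adjointFactor_nonneg {T t : ℝ} (U : ℝ → ℝ) (ht : t ≤ T) : 0 ≤ adjointFactor T U t :=
  intervalIntegral.integral_nonneg ht fun _ _ => (exp_pos _).le

lemma hasDerivAt_stateFactor_mul_adjointFactor (R₀ c T : ℝ) {U V : ℝ → ℝ} (hU : Continuous U)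
    (hV : Continuous V) (t : ℝ) :
    HasDerivAt (fun t => stateFactor R₀ c V t * adjointFactor T U t)
      (c * exp (V t) * adjointFactor T U t - stateFactor R₀ c V t * exp (-U t)) t := by
  convert! (hasDerivAt_stateFactor R₀ c hV t).mul (hasDerivAt_adjointFactor T hU t) using 1
  ring

/-- At an interior minimum where the switching function does not exceed the threshold, it would
have to decrease strictly to the right; hence it exceeds the threshold between any two points
where it reaches it. -/
lemma lt_switching_of_mem_Ioo {α β c u₁ T R₀ : ℝ} (hα : 0 < α) (hβ : 0 < β) (hc : 0 < c)
    (hu₁ : 0 < u₁) (hns : √(α * c / β) > u₁) {U : ℝ → ℝ} (hU : Continuous U)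
    (hUlip : ∀ s t, s ≤ t → U t ≤ U s + u₁ * (t - s)) {a b m : ℝ} (hbT : b ≤ T)
    (ha : β ≤ α * (stateFactor R₀ c U a * adjointFactor T U a))
    (hb : β ≤ α * (stateFactor R₀ c U b * adjointFactor T U b)) (hm : m ∈ Ioo a b) :
    β < α * (stateFactor R₀ c U m * adjointFactor T U m) := by
  by_contra! hle
  set g : ℝ → ℝ := fun t => α * (stateFactor R₀ c U t * adjointFactor T U t) with hg
  have hder (t : ℝ) : HasDerivAt g
      (α * (c * exp (U t) * adjointFactor T U t - stateFactor R₀ c U t * exp (-U t))) t :=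
    (hasDerivAt_stateFactor_mul_adjointFactor R₀ c T hU hU t).const_mul α
  have hgc : Continuous g := continuous_iff_continuousAt.2 fun t => (hder t).continuousAt
  obtain ⟨n, hn, hnβ, hmin⟩ : ∃ n ∈ Ioo a b, g n ≤ β ∧ ∀ t ∈ Icc a b, g n ≤ g t := by
    obtain ⟨n, hn, hmin⟩ := isCompact_Icc.exists_isMinOn ⟨m, Ioo_subset_Icc_self hm⟩
      hgc.continuousOn
    have hnm : g n ≤ g m := hmin (Ioo_subset_Icc_self hm)
    rcases hnm.lt_or_eq with h | h
    · have hnβ : g n < β := h.trans_le hle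
      refine ⟨n, ⟨lt_of_le_of_ne hn.1 ?_, lt_of_le_of_ne hn.2 ?_⟩, hnβ.le, fun t ht => hmin ht⟩
      · rintro rfl; exact absurd ha hnβ.not_ge
      · rintro rfl; exact absurd hb hnβ.not_ge
    · exact ⟨m, hm, hle, fun t ht => h ▸ hmin ht⟩
  have hcrit : c * exp (U n) * adjointFactor T U n = stateFactor R₀ c U n * exp (-U n) := by
    have hloc : IsLocalMin g n :=
      Filter.eventually_of_mem (Icc_mem_nhds hn.1 hn.2) fun t ht => hmin t ht
    have := hloc.hasDerivAt_eq_zero (hder n)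
    rcases mul_eq_zero.1 this with h | h
    · exact absurd h hα.ne'
    · linarith
  have hEE : exp (U n) * exp (-U n) = 1 := by rw [← exp_add]; simp
  have hA : stateFactor R₀ c U n = c * exp (U n) ^ 2 * adjointFactor T U n := by
    linear_combination (-stateFactor R₀ c U n) * hEE - exp (U n) * hcrit
  have hsub : u₁ * (exp (U n) * adjointFactor T U n) < 1 := by
    have h1 : u₁ ^ 2 < α * c / β := (Real.lt_sqrt hu₁.le).1 hns
    have h2 : α * c * (exp (U n) * adjointFactor T U n) ^ 2 ≤ β := by
      have : g n ≤ β := hnβ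
      simp only [hg, hA] at this
      linarith
    rw [lt_div_iff₀ hβ] at h1
    have h3 : (u₁ * (exp (U n) * adjointFactor T U n)) ^ 2 < 1 ^ 2 := by
      have hpos : 0 < α * c := mul_pos hα hc
      have h4 := mul_le_mul_of_nonneg_left h2 (sq_nonneg u₁)
      rw [one_pow, mul_pow]
      by_contra! h5
      nlinarith [mul_le_mul_of_nonneg_left h5 hpos.le]
    exact lt_of_pow_lt_pow_left₀ 2 zero_le_one h3
  set f : ℝ → ℝ := fun t =>
    c * exp (U n + u₁ * (t - n)) ^ 2 * adjointFactor T U t - stateFactor R₀ c U t with hf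
  have hfn : f n = 0 := by simp [hf, hA]
  have hfd : HasDerivAt f (2 * c * exp (U n) * (u₁ * (exp (U n) * adjointFactor T U n) - 1)) n := by
    have hlin : HasDerivAt (fun t => U n + u₁ * (t - n)) u₁ n := by
      simpa using (((hasDerivAt_id n).sub_const n).const_mul u₁).const_add (U n)
    convert! (((hlin.exp.pow 2).const_mul c).mul (hasDerivAt_adjointFactor T hU n)).sub
      (hasDerivAt_stateFactor R₀ c hU n) using 1
    simp
    linear_combination (c * exp (U n)) * hEE
  have hneg : 2 * c * exp (U n) * (u₁ * (exp (U n) * adjointFactor T U n) - 1) < 0 :=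
    mul_neg_of_pos_of_neg (by positivity) (by linarith)
  have hev : ∀ᶠ t in 𝓝[>] n, f t < 0 := by
    filter_upwards [hfd.hasDerivWithinAt.limsup_slope_le' (s := Ioi n) (by simp) hneg,
      self_mem_nhdsWithin] with t ht hnt
    rw [slope_def_field, hfn, sub_zero, div_lt_iff₀ (sub_pos.2 hnt), zero_mul] at ht
    exact ht
  obtain ⟨r, hr, hrf⟩ := (mem_nhdsGT_iff_exists_Ioo_subset' hn.2).1 hev
  have hnr : n < min r b := lt_min hr hn.2
  have hanti : StrictAntiOn g (Icc n (min r b)) := by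
    refine strictAntiOn_of_hasDerivWithinAt_neg (convex_Icc _ _) hgc.continuousOn
      (fun t _ => (hder t).hasDerivWithinAt) fun t ht => ?_
    rw [interior_Icc] at ht
    have hft : f t < 0 := hrf ⟨ht.1, ht.2.trans_le (min_le_left _ _)⟩
    have hB : 0 ≤ adjointFactor T U t :=
      adjointFactor_nonneg U ((ht.2.trans_le (min_le_right _ _)).le.trans hbT)
    have hexp : exp (U t) ≤ exp (U n + u₁ * (t - n)) := exp_le_exp.2 (hUlip n t ht.1.le)
    have hfac : c * exp (U t) ^ 2 * adjointFactor T U t - stateFactor R₀ c U t < 0 := by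
      refine lt_of_le_of_lt ?_ hft
      simp only [hf]
      gcongr
    have hEt : exp (U t) * exp (-U t) = 1 := by rw [← exp_add]; simp
    have : c * exp (U t) * adjointFactor T U t - stateFactor R₀ c U t * exp (-U t)
        = exp (-U t) * (c * exp (U t) ^ 2 * adjointFactor T U t - stateFactor R₀ c U t) := by
      linear_combination (-c * exp (U t) * adjointFactor T U t) * hEt
    rw [this]
    exact mul_neg_of_pos_of_neg hα (mul_neg_of_pos_of_neg (exp_pos _) hfac)
  have hlt := hanti (left_mem_Icc.2 hnr.le) (right_mem_Icc.2 hnr.le) hnr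
  exact absurd (hmin _ ⟨hn.1.le.trans hnr.le, min_le_right _ _⟩) hlt.not_ge

lemma intervalIntegrable_of_abs_le {w : ℝ → ℝ} {M : ℝ} (hw : Measurable w)
    (hM : ∀ t, |w t| ≤ M) (a b : ℝ) : IntervalIntegrable w volume a b :=
  (intervalIntegrable_const (c := M)).mono_fun hw.aestronglyMeasurable
    (ae_of_all _ fun t => (hM t).trans (le_abs_self M))

lemma lipschitzWith_primitive {w : ℝ → ℝ} {M : ℝ} (hw : Measurable w) (hM : ∀ t, |w t| ≤ M) :
    LipschitzWith M.toNNReal fun t => ∫ s in (0:ℝ)..t, w s := by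
  refine LipschitzWith.of_dist_le' fun x y => ?_
  rw [Real.dist_eq, Real.dist_eq, intervalIntegral.integral_interval_sub_left
    (intervalIntegrable_of_abs_le hw hM _ _) (intervalIntegrable_of_abs_le hw hM _ _)]
  exact intervalIntegral.norm_integral_le_of_norm_le_const (f := w) fun t _ => hM t

/-- The fundamental theorem of calculus for `φ` times an exponential integrating factor with a
merely bounded measurable rate. -/
lemma integral_exp_neg_primitive_mul {w φ φ' : ℝ → ℝ} {M : ℝ} (hw : Measurable w)
    (hM : ∀ t, |w t| ≤ M) (hφ : ∀ t, HasDerivAt φ (φ' t) t) (hφ' : Continuous φ') (T : ℝ) :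
    (∫ t in (0:ℝ)..T, exp (-∫ s in (0:ℝ)..t, w s) * φ' t)
      - (∫ t in (0:ℝ)..T, w t * (exp (-∫ s in (0:ℝ)..t, w s) * φ t))
      = exp (-∫ s in (0:ℝ)..T, w s) * φ T - φ 0 := by
  set W : ℝ → ℝ := fun t => ∫ s in (0:ℝ)..t, w s with hW
  have hWlip : LipschitzWith M.toNNReal W := lipschitzWith_primitive hw hM
  have hφc : Continuous φ := continuous_iff_continuousAt.2 fun t => (hφ t).continuousAt
  have hWc := hWlip.continuous
  have hEc : Continuous fun t => exp (-W t) := by fun_prop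
  have hexp : AbsolutelyContinuousOnInterval (fun t => exp (-W t)) 0 T := by
    obtain ⟨r, hr⟩ := (isCompact_uIcc.image hWc.neg).isBounded.subset_closedBall (0 : ℝ)
    obtain ⟨K, hK⟩ := (Real.contDiff_exp (n := 1)).contDiffOn.exists_lipschitzOnWith
      (by decide) (convex_closedBall (0 : ℝ) r) (isCompact_closedBall 0 r)
    exact (hK.comp hWlip.neg.lipschitzOnWith
      (mapsTo_iff_image_subset.2 hr)).absolutelyContinuousOnInterval
  have hφac : AbsolutelyContinuousOnInterval φ 0 T :=
    (contDiff_one_iff_deriv.2 ⟨fun t => (hφ t).differentiableAt, by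
      rwa [funext fun t => (hφ t).deriv]⟩).contDiffOn.absolutelyContinuousOnInterval
  have hkey := (hexp.fun_mul hφac).integral_deriv_eq_sub
  have hW0 : W 0 = 0 := by simp [hW]
  rw [hW0, neg_zero, exp_zero, one_mul] at hkey
  rw [← hkey, ← intervalIntegral.integral_sub]
  · refine intervalIntegral.integral_congr_ae ?_
    filter_upwards [(intervalIntegrable_of_abs_le hw hM 0 T).ae_hasDerivAt_integral] with t ht hmem
    have hd : HasDerivAt W (w t) t := ht (uIoc_subset_uIcc hmem) 0 left_mem_uIcc
    refine Eq.trans ?_ (hd.neg.exp.mul (hφ t)).deriv.symm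
    simp only [Pi.neg_apply, hW]
    ring
  · exact (hEc.mul hφ').intervalIntegrable _ _
  · exact (intervalIntegrable_of_abs_le hw hM 0 T).mul_continuousOn
      (hEc.mul hφc).continuousOn

lemma Kstate_eq {R₀ c M : ℝ} {u : ℝ → ℝ} (hu : Measurable u) (hM : ∀ t, |u t| ≤ M) (t : ℝ) :
    Kstate R₀ c u t
      = exp (-∫ s in (0:ℝ)..t, u s) * stateFactor R₀ c (fun t => ∫ s in (0:ℝ)..t, u s) t := by
  have h : ∀ s, exp (-∫ ξ in s..t, u ξ)
      = exp (-∫ ξ in (0:ℝ)..t, u ξ) * exp (∫ ξ in (0:ℝ)..s, u ξ) := fun s => by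
    rw [← intervalIntegral.integral_interval_sub_left (intervalIntegrable_of_abs_le hu hM 0 t)
      (intervalIntegrable_of_abs_le hu hM 0 s), ← exp_add]
    ring_nf
  rw [Kstate, stateFactor, intervalIntegral.integral_congr fun s _ => h s,
    intervalIntegral.integral_const_mul]
  ring

lemma Jcost_eq {α β c T R₀ M : ℝ} {u : ℝ → ℝ} (hu : Measurable u) (hM : ∀ t, |u t| ≤ M) :
    Jcost α β c T R₀ u
      = α * (∫ t in (0:ℝ)..T, exp (-∫ s in (0:ℝ)..t, u s) *
          stateFactor R₀ c (fun t => ∫ s in (0:ℝ)..t, u s) t) + β * ∫ t in (0:ℝ)..T, u t := by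
  have hU := (lipschitzWith_primitive hu hM).continuous
  have hE : Continuous fun t => exp (-∫ s in (0:ℝ)..t, u s) := hU.neg.rexp
  simp only [Jcost, Kstate_eq hu hM]
  rw [intervalIntegral.integral_add, intervalIntegral.integral_const_mul,
    intervalIntegral.integral_const_mul]
  · exact ((hE.mul (continuous_stateFactor R₀ c hU)).const_mul α).intervalIntegrable _ _
  · exact (intervalIntegrable_of_abs_le hu hM 0 T).const_mul β

/-- Exact difference of costs: the state is that of `v` and the adjoint that of `u`. -/
lemma Jcost_sub {α β c T R₀ M : ℝ} {u v : ℝ → ℝ} (hu : Measurable u) (hv : Measurable v)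
    (huM : ∀ t, |u t| ≤ M) (hvM : ∀ t, |v t| ≤ M) :
    Jcost α β c T R₀ v - Jcost α β c T R₀ u
      = ∫ t in (0:ℝ)..T, (v t - u t) * (β - α * (exp (-∫ s in (0:ℝ)..t, (v s - u s)) *
          (stateFactor R₀ c (fun t => ∫ s in (0:ℝ)..t, v s) t *
            adjointFactor T (fun t => ∫ s in (0:ℝ)..t, u s) t))) := by
  have hui := intervalIntegrable_of_abs_le hu huM
  have hvi := intervalIntegrable_of_abs_le hv hvM
  have hwm : Measurable fun t => v t - u t := hv.sub hu
  have hwM (t : ℝ) : |v t - u t| ≤ M + M := (abs_sub _ _).trans (add_le_add (hvM t) (huM t))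
  have hU := (lipschitzWith_primitive hu huM).continuous
  have hV := (lipschitzWith_primitive hv hvM).continuous
  have hW := (lipschitzWith_primitive hwm hwM).continuous
  have hWeq (t : ℝ) : ∫ s in (0:ℝ)..t, (v s - u s)
      = (∫ s in (0:ℝ)..t, v s) - ∫ s in (0:ℝ)..t, u s :=
    intervalIntegral.integral_sub (hvi 0 t) (hui 0 t)
  have key := integral_exp_neg_primitive_mul hwm hwM
    (hasDerivAt_stateFactor_mul_adjointFactor R₀ c T hU hV)
    (((hV.rexp.const_mul c).mul (continuous_adjointFactor T hU)).sub
      ((continuous_stateFactor R₀ c hV).mul hU.neg.rexp)) T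
  have key₀ := integral_exp_neg_primitive_mul (w := fun _ => 0) (M := 0) measurable_const (by simp)
    (hasDerivAt_stateFactor_mul_adjointFactor R₀ c T hU hU)
    (((hU.rexp.const_mul c).mul (continuous_adjointFactor T hU)).sub
      ((continuous_stateFactor R₀ c hU).mul hU.neg.rexp)) T
  set U : ℝ → ℝ := fun t => ∫ s in (0:ℝ)..t, u s with hUdef
  set V : ℝ → ℝ := fun t => ∫ s in (0:ℝ)..t, v s with hVdef
  have hJu : Jcost α β c T R₀ u
      = α * (∫ t in (0:ℝ)..T, exp (-U t) * stateFactor R₀ c U t) + β * U T := Jcost_eq hu huM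
  have hJv : Jcost α β c T R₀ v
      = α * (∫ t in (0:ℝ)..T, exp (-V t) * stateFactor R₀ c V t) + β * V T := Jcost_eq hv hvM
  have hAV := continuous_stateFactor R₀ c hV
  have hAU := continuous_stateFactor R₀ c hU
  have hB := continuous_adjointFactor T hU
  have hBT : adjointFactor T U T = 0 := by simp [adjointFactor]
  have hA0 (X : ℝ → ℝ) : stateFactor R₀ c X 0 = R₀ := by simp [stateFactor]
  have hsplit : ∫ t in (0:ℝ)..T, exp (-∫ s in (0:ℝ)..t, (v s - u s)) *
      (c * exp (V t) * adjointFactor T U t - stateFactor R₀ c V t * exp (-U t))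
      = (∫ t in (0:ℝ)..T, c * exp (U t) * adjointFactor T U t)
        - ∫ t in (0:ℝ)..T, exp (-V t) * stateFactor R₀ c V t := by
    rw [← intervalIntegral.integral_sub]
    · refine intervalIntegral.integral_congr fun t _ => ?_
      have h1 : exp (-(V t - U t)) * exp (V t) = exp (U t) := by rw [← exp_add]; ring_nf
      have h2 : exp (-(V t - U t)) * exp (-U t) = exp (-V t) := by rw [← exp_add]; ring_nf
      simp only [hWeq]
      linear_combination (c * adjointFactor T U t) * h1 - stateFactor R₀ c V t * h2
    · exact ((hU.rexp.const_mul c).mul hB).intervalIntegrable _ _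
    · exact (hV.neg.rexp.mul hAV).intervalIntegrable _ _
  have hsplit₀ : ∫ t in (0:ℝ)..T,
      (c * exp (U t) * adjointFactor T U t - stateFactor R₀ c U t * exp (-U t))
      = (∫ t in (0:ℝ)..T, c * exp (U t) * adjointFactor T U t)
        - ∫ t in (0:ℝ)..T, exp (-U t) * stateFactor R₀ c U t := by
    rw [← intervalIntegral.integral_sub]
    · refine intervalIntegral.integral_congr fun t _ => ?_
      ring
    · exact ((hU.rexp.const_mul c).mul hB).intervalIntegrable _ _
    · exact (hU.neg.rexp.mul hAU).intervalIntegrable _ _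
  simp only [intervalIntegral.integral_zero, neg_zero, exp_zero, one_mul, zero_mul, sub_zero,
    hBT, mul_zero, hA0, zero_sub] at key₀
  replace key₀ := hsplit₀.symm.trans key₀
  rw [hsplit, hBT, hA0] at key
  have hlin : ∫ t in (0:ℝ)..T, (v t - u t) * (β - α * (exp (-∫ s in (0:ℝ)..t, (v s - u s)) *
        (stateFactor R₀ c V t * adjointFactor T U t)))
      = β * (∫ t in (0:ℝ)..T, (v t - u t)) - α * ∫ t in (0:ℝ)..T, (v t - u t) *
        (exp (-∫ s in (0:ℝ)..t, (v s - u s)) * (stateFactor R₀ c V t * adjointFactor T U t)) := by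
    rw [← intervalIntegral.integral_const_mul, ← intervalIntegral.integral_const_mul,
      ← intervalIntegral.integral_sub]
    · refine intervalIntegral.integral_congr fun t _ => ?_
      ring
    · exact (intervalIntegrable_of_abs_le hwm hwM 0 T).const_mul β
    · exact ((intervalIntegrable_of_abs_le hwm hwM 0 T).mul_continuousOn
        (hW.neg.rexp.mul (hAV.mul hB)).continuousOn).const_mul α
  rw [hJu, hJv, hlin, hWeq]
  linear_combination α * (key₀ - key)

/-- The pointwise minimum principle, with switching function `α A B`. -/
lemma ae_eq_of_optimal {α β c u₁ T R₀ : ℝ} (hT : 0 ≤ T) {u : ℝ → ℝ} (hu : Measurable u)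
    (huI : ∀ t, u t ∈ Icc 0 u₁)
    (hopt : ∀ v, Measurable v → (∀ t, v t ∈ Icc 0 u₁) → Jcost α β c T R₀ u ≤ Jcost α β c T R₀ v)
    {g : ℝ → ℝ} (hg : ∀ t, g t = α * (stateFactor R₀ c (fun t => ∫ s in (0:ℝ)..t, u s) t *
      adjointFactor T (fun t => ∫ s in (0:ℝ)..t, u s) t)) :
    ∀ᵐ t ∂volume.restrict (Ioc 0 T), (g t < β → u t = 0) ∧ (β < g t → u t = u₁) := by
  have hu₁ : 0 ≤ u₁ := (huI 0).1.trans (huI 0).2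
  have habs {x : ℝ} (hx : x ∈ Icc 0 u₁) : |x| ≤ u₁ := abs_le.2 ⟨by linarith [hx.1], hx.2⟩
  have huM (t : ℝ) : |u t| ≤ u₁ := habs (huI t)
  have hU := (lipschitzWith_primitive hu huM).continuous
  have hui := intervalIntegrable_of_abs_le hu huM
  have hgc : Continuous g := by
    rw [funext hg]
    exact ((continuous_stateFactor R₀ c hU).mul (continuous_adjointFactor T hU)).const_mul α
  set v : ℝ → ℝ := fun t => if g t < β then 0 else if β < g t then u₁ else u t with hv
  have hvm : Measurable v :=
    Measurable.ite (measurableSet_lt hgc.measurable measurable_const) measurable_const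
      (Measurable.ite (measurableSet_lt measurable_const hgc.measurable) measurable_const hu)
  have hvI (t : ℝ) : v t ∈ Icc 0 u₁ := by
    simp only [hv]
    split_ifs
    exacts [⟨le_rfl, hu₁⟩, ⟨hu₁, le_rfl⟩, huI t]
  set w : ℝ → ℝ := fun t => v t - u t with hw
  have hwm : Measurable w := hvm.sub hu
  have hwM (t : ℝ) : |w t| ≤ u₁ :=
    abs_le.2 ⟨by linarith [(hvI t).1, (huI t).2], by linarith [(hvI t).2, (huI t).1]⟩
  have hwi := intervalIntegrable_of_abs_le hwm hwM
  have hW := (lipschitzWith_primitive hwm hwM).continuous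
  set U : ℝ → ℝ := fun t => ∫ s in (0:ℝ)..t, u s with hUdef
  set W : ℝ → ℝ := fun t => ∫ s in (0:ℝ)..t, w s with hWdef
  have hB := continuous_adjointFactor T hU
  set G : ℝ → ℝ → ℝ := fun ε t =>
    exp (-(ε * W t)) * (stateFactor R₀ c (fun s => U s + ε * W s) t * adjointFactor T U t) with hG
  have hGc : Continuous G.uncurry := by
    have hInt : Continuous fun p : ℝ × ℝ => ∫ s in (0:ℝ)..p.2, exp (U s + p.1 * W s) :=
      intervalIntegral.continuous_parametric_intervalIntegral_of_continuous
        (f := fun (p : ℝ × ℝ) s => exp (U s + p.1 * W s)) (by fun_prop) continuous_snd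
    simp only [hG, stateFactor]
    fun_prop
  have hvar (ε : ℝ) (hε : ε ∈ Ioc (0:ℝ) 1) : 0 ≤ ∫ t in (0:ℝ)..T, w t * (β - α * G ε t) := by
    have hzm : Measurable fun t => u t + ε * w t := hu.add (hwm.const_mul ε)
    have hzI (t : ℝ) : u t + ε * w t ∈ Icc 0 u₁ := by
      have h := (convex_Icc (0:ℝ) u₁) (huI t) (hvI t) (sub_nonneg.2 hε.2) hε.1.le (by ring)
      simp only [smul_eq_mul] at h
      convert! h using 1
      simp only [hw]
      ring
    have hdiff := Jcost_sub (α := α) (β := β) (c := c) (T := T) (R₀ := R₀) hu hzm huM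
      fun t => habs (hzI t)
    have hZ : (fun t => ∫ s in (0:ℝ)..t, (u s + ε * w s)) = fun t => U t + ε * W t := by
      funext t
      rw [intervalIntegral.integral_add (hui 0 t) ((hwi 0 t).const_mul ε),
        intervalIntegral.integral_const_mul]
    simp only [add_sub_cancel_left, intervalIntegral.integral_const_mul, hZ, mul_assoc ε] at hdiff
    have h := sub_nonneg.2 (hopt _ hzm hzI)
    rw [hdiff] at h
    exact nonneg_of_mul_nonneg_right h hε.1
  have hlim : 0 ≤ ∫ t in (0:ℝ)..T, w t * (β - α * G 0 t) := by
    obtain ⟨C, hC⟩ := ((isCompact_Icc (a := (0:ℝ)) (b := 1)).prod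
      (isCompact_Icc (a := (0:ℝ)) (b := T))).exists_bound_of_continuousOn
      (f := fun p : ℝ × ℝ => β - α * G.uncurry p) (by fun_prop)
    have hGε (ε : ℝ) : Continuous (G ε) := hGc.comp (by fun_prop : Continuous fun t => (ε, t))
    have hGt (t : ℝ) : Continuous fun ε => G ε t :=
      hGc.comp (by fun_prop : Continuous fun ε : ℝ => (ε, t))
    have hcont : ContinuousWithinAt (fun ε => ∫ t in (0:ℝ)..T, w t * (β - α * G ε t))
        (Ioc 0 1) 0 := by
      refine intervalIntegral.continuousWithinAt_of_dominated_interval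
        (bound := fun _ => u₁ * C) ?_ ?_ intervalIntegrable_const ?_
      · refine Eventually.of_forall fun ε => ?_
        exact (hwm.mul (measurable_const.sub
          ((hGε ε).measurable.const_mul α))).aestronglyMeasurable
      · filter_upwards [self_mem_nhdsWithin] with ε hε
        refine ae_of_all _ fun t ht => ?_
        rw [uIoc_of_le hT] at ht
        rw [norm_mul]
        exact mul_le_mul (hwM t) (hC (ε, t) ⟨Ioc_subset_Icc_self hε, Ioc_subset_Icc_self ht⟩)
          (norm_nonneg _) hu₁
      · refine ae_of_all _ fun t _ => Continuous.continuousWithinAt ?_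
        have := hGt t
        fun_prop
    have : (𝓝[Ioc (0:ℝ) 1] 0).NeBot := by
      rw [nhdsWithin_Ioc_eq_nhdsGT zero_lt_one]; infer_instance
    exact ge_of_tendsto hcont.tendsto (eventually_mem_nhdsWithin.mono hvar)
  have hG0 (t : ℝ) : α * G 0 t = g t := by simp [hG, hg]
  simp only [hG0] at hlim
  have hnn (t : ℝ) : 0 ≤ -(w t * (β - g t)) := by
    simp only [hw, hv]
    split_ifs with h1 h2
    · nlinarith [(huI t).1]
    · nlinarith [(huI t).2]
    · simp
  have hInt : IntervalIntegrable (fun t => -(w t * (β - g t))) volume 0 T :=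
    ((hwi 0 T).mul_continuousOn (by fun_prop)).neg
  have hzero : ∫ t in (0:ℝ)..T, -(w t * (β - g t)) = 0 := by
    refine le_antisymm ?_ (intervalIntegral.integral_nonneg hT fun t _ => hnn t)
    rw [intervalIntegral.integral_neg]
    linarith
  filter_upwards [(intervalIntegral.integral_eq_zero_iff_of_le_of_nonneg_ae hT
    (ae_of_all _ hnn) hInt).1 hzero] with t ht
  have ht' : w t * (β - g t) = 0 := neg_eq_zero.1 ht
  constructor <;> intro h
  · have hwt : w t = 0 := (mul_eq_zero.1 ht').resolve_right (by linarith)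
    simp only [hw, hv, if_pos h] at hwt
    linarith
  · have hwt : w t = 0 := (mul_eq_zero.1 ht').resolve_right (by linarith)
    simp only [hw, hv, if_neg h.not_gt, if_pos h] at hwt
    linarith

/-- Replacing a control by an a.e. equal one on the horizon leaves the cost unchanged. -/
lemma Jcost_congr {α β c T R₀ : ℝ} (hT : 0 ≤ T) {u v : ℝ → ℝ}
    (h : ∀ᵐ t ∂volume.restrict (Icc 0 T), u t = v t) :
    Jcost α β c T R₀ u = Jcost α β c T R₀ v := by
  rw [ae_restrict_iff' measurableSet_Icc] at h
  have hsub {s t : ℝ} (hs : s ∈ Icc 0 T) (ht : t ∈ Icc 0 T) :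
      ∫ ξ in s..t, u ξ = ∫ ξ in s..t, v ξ := by
    refine intervalIntegral.integral_congr_ae ?_
    filter_upwards [h] with ξ hξ hmem
    exact hξ (uIcc_subset_Icc hs ht (uIoc_subset_uIcc hmem))
  have h0 : (0:ℝ) ∈ Icc 0 T := ⟨le_rfl, hT⟩
  refine intervalIntegral.integral_congr_ae ?_
  filter_upwards [h] with t ht hmem
  rw [uIoc_of_le hT] at hmem
  have htI := Ioc_subset_Icc_self hmem
  have hinner : ∫ s in (0:ℝ)..t, exp (-∫ ξ in s..t, u ξ)
      = ∫ s in (0:ℝ)..t, exp (-∫ ξ in s..t, v ξ) :=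
    intervalIntegral.integral_congr fun s hs => by
      simp only [hsub (uIcc_subset_Icc h0 htI hs) htI]
  rw [Kstate, Kstate, hsub h0 htI, hinner, ht htI]

/-- If a function exceeds `β` strictly between any two points of `[0, T]` where it is at least
`β`, then its superlevel set is an interval up to endpoints. -/
lemma exists_superlevel_interval {g : ℝ → ℝ} {β T : ℝ} (hT : 0 ≤ T)
    (h : ∀ a ∈ Icc 0 T, ∀ b ∈ Icc 0 T, β ≤ g a → β ≤ g b → ∀ m ∈ Ioo a b, β < g m) :
    ∃ t₁ t₂, 0 ≤ t₁ ∧ t₁ ≤ t₂ ∧ t₂ ≤ T ∧ (∀ t ∈ Ioo 0 t₁, g t < β) ∧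
      (∀ t ∈ Ioo t₁ t₂, β < g t) ∧ ∀ t ∈ Ioo t₂ T, g t < β := by
  set S : Set ℝ := {t ∈ Icc 0 T | β ≤ g t} with hS
  rcases S.eq_empty_or_nonempty with hSe | hSn
  · refine ⟨0, 0, le_rfl, le_rfl, hT, by simp, by simp, fun t ht => ?_⟩
    by_contra! hβ
    exact (hSe ▸ (⟨Ioo_subset_Icc_self ht, hβ⟩ : t ∈ S) : t ∈ (∅ : Set ℝ))
  have hlo : BddBelow S := ⟨0, fun t ht => ht.1.1⟩
  have hhi : BddAbove S := ⟨T, fun t ht => ht.1.2⟩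
  have h0 : 0 ≤ sInf S := le_csInf hSn fun t ht => ht.1.1
  have h1 : sSup S ≤ T := csSup_le hSn fun t ht => ht.1.2
  have h01 : sInf S ≤ sSup S := csInf_le_csSup hSn hlo hhi
  refine ⟨sInf S, sSup S, h0, h01, h1, fun t ht => ?_, fun t ht => ?_, fun t ht => ?_⟩
  · by_contra! hβ
    exact ht.2.not_ge (csInf_le hlo ⟨⟨ht.1.le, ht.2.le.trans (h01.trans h1)⟩, hβ⟩)
  · obtain ⟨a, ha, hat⟩ := exists_lt_of_csInf_lt hSn ht.1
    obtain ⟨b, hb, htb⟩ := exists_lt_of_lt_csSup hSn ht.2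
    exact h a ha.1 b hb.1 ha.2 hb.2 t ⟨hat, htb⟩
  · by_contra! hβ
    exact ht.1.not_ge (le_csSup hhi ⟨⟨(h0.trans h01).trans ht.1.le, ht.2.le⟩, hβ⟩)

end

/-- Theorem 1: in the nonsingular case `√(αc/β) > u₁` with `R₀ ≥ 0`,
any optimal control is bang-bang of the form `0 → u₁ → 0`, with at most two switchings. -/
theorem optimal_control_structure_nonsingular (α β c u₁ T R₀ : ℝ)
    (hα : 0 < α) (hβ : 0 < β) (hc : 0 < c) (hu₁ : 0 < u₁) (hT : 0 < T)
    (hR₀ : 0 ≤ R₀) (hns : Real.sqrt (α * c / β) > u₁)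
    (uo : ℝ → ℝ) (huo : Admissible T u₁ uo)
    (hopt : ∀ u : ℝ → ℝ, Admissible T u₁ u → Jcost α β c T R₀ uo ≤ Jcost α β c T R₀ u) :
    ∃ t₁ t₂ : ℝ, 0 ≤ t₁ ∧ t₁ ≤ t₂ ∧ t₂ ≤ T ∧
      (∀ᵐ t ∂(volume.restrict (Set.Ioo (0:ℝ) t₁)), uo t = 0) ∧
      (∀ᵐ t ∂(volume.restrict (Set.Ioo t₁ t₂)), uo t = u₁) ∧
      (∀ᵐ t ∂(volume.restrict (Set.Ioo t₂ T)), uo t = 0) := by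
  have hT₀ := hT.le
  set u : ℝ → ℝ := fun t => max 0 (min (uo t) u₁) with hu
  have hum : Measurable u := measurable_const.max (huo.1.min measurable_const)
  have huI (t : ℝ) : u t ∈ Set.Icc 0 u₁ :=
    ⟨le_max_left _ _, max_le hu₁.le (min_le_right _ _)⟩
  have huuo : ∀ᵐ t ∂volume.restrict (Set.Icc 0 T), u t = uo t := by
    filter_upwards [huo.2] with t ht
    simp [hu, ht.1, ht.2]
  have huM (t : ℝ) : |u t| ≤ u₁ := by
    rw [abs_of_nonneg (huI t).1]; exact (huI t).2
  have hU := (lipschitzWith_primitive hum huM).continuous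
  have hae := ae_eq_of_optimal (α := α) (β := β) (c := c) (R₀ := R₀) hT₀ hum huI
    (fun v hv hvI => Jcost_congr (α := α) (β := β) (c := c) (R₀ := R₀) hT₀ huuo ▸
      hopt v ⟨hv, ae_of_all _ hvI⟩) fun _ => rfl
  obtain ⟨t₁, t₂, h0, h12, h2T, hI₁, hI₂, hI₃⟩ := exists_superlevel_interval hT₀
    fun a _ b hb hga hgb m hm => lt_switching_of_mem_Ioo hα hβ hc hu₁ hns hU
      (fun s t hst => by
        have hui := intervalIntegrable_of_abs_le hum huM
        have h := intervalIntegral.integral_mono_on hst (hui s t) intervalIntegrable_const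
          fun ξ _ => (huI ξ).2
        rw [← intervalIntegral.integral_interval_sub_left (hui 0 t) (hui 0 s),
          intervalIntegral.integral_const, smul_eq_mul] at h
        linarith) hb.2 hga hgb hm
  have transfer {p q x : ℝ} (hp : 0 ≤ p) (hq : q ≤ T)
      (h : ∀ᵐ t ∂volume.restrict (Set.Ioc 0 T), t ∈ Set.Ioo p q → u t = x) :
      ∀ᵐ t ∂volume.restrict (Set.Ioo p q), uo t = x := by
    have hsub : Set.Ioo p q ⊆ Set.Ioc 0 T := fun t ht => ⟨hp.trans_lt ht.1, ht.2.le.trans hq⟩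
    filter_upwards [ae_restrict_of_ae_restrict_of_subset hsub h,
      ae_restrict_of_ae_restrict_of_subset (hsub.trans Set.Ioc_subset_Icc_self) huuo,
      ae_restrict_mem measurableSet_Ioo] with t h₁ h₂ h₃
    rw [← h₂, h₁ h₃]
  exact ⟨t₁, t₂, h0, h12, h2T,
    transfer le_rfl (h12.trans h2T) (hae.mono fun t ht hmem => ht.1 (hI₁ t hmem)),
    transfer h0 h2T (hae.mono fun t ht hmem => ht.2 (hI₂ t hmem)),
    transfer (h0.trans h12) le_rfl (hae.mono fun t ht hmem => ht.1 (hI₃ t hmem))⟩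
end

section
/- (Theorem 2, structure of optimal control in the singular case.) Suppose √(αc/β) ≤ u₁ and R₀ ≥ 0, and set u_s = √(αc/β). Let û be an admissible control minimizing J. Then there exist times 0 ≤ t₁ ≤ t₂ ≤ T and a value v ∈ {0, u₁} such that û(t) = v for almost every t ∈ (0, t₁), û(t) = u_s for almost every t ∈ (t₁, t₂), and û(t) = 0 for almost every t ∈ (t₂, T). In particular, the number of control switchings does not exceed 2 and the optimal solution may contain a singular arc with constant control u_s. -/
open MeasureTheory Real

/-- The accumulated control `∫₀ᵗ u`. -/
noncomputable def cumulControl (u : ℝ → ℝ) (t : ℝ) : ℝ := ∫ ξ in (0:ℝ)..t, u ξ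

/-- The state multiplied by the integrating factor `exp (∫₀ᵗ u)`. -/
noncomputable def scaledState (R₀ c : ℝ) (u : ℝ → ℝ) (t : ℝ) : ℝ :=
  R₀ + c * ∫ s in (0:ℝ)..t, Real.exp (cumulControl u s)

/-- The costate multiplied by the integrating factor `exp (-∫₀ᵗ u)`. -/
noncomputable def scaledCostate (α T : ℝ) (u : ℝ → ℝ) (t : ℝ) : ℝ :=
  α * ∫ s in t..T, Real.exp (-cumulControl u s)

/-- The switching function: the gradient of the cost with respect to the control. -/
noncomputable def switchingFun (α β c T R₀ : ℝ) (u : ℝ → ℝ) (t : ℝ) : ℝ :=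
  β - scaledCostate α T u t * scaledState R₀ c u t

section Basic

variable {α β c u₁ T R₀ : ℝ} {u h : ℝ → ℝ}

lemma continuous_cumulControl (hu : ∀ a b, IntervalIntegrable u volume a b) :
    Continuous (cumulControl u) :=
  intervalIntegral.continuous_primitive hu 0

lemma integral_eq_cumulControl_sub (hu : ∀ a b, IntervalIntegrable u volume a b) (s t : ℝ) :
    ∫ ξ in s..t, u ξ = cumulControl u t - cumulControl u s :=
  (intervalIntegral.integral_interval_sub_left (hu 0 t) (hu 0 s)).symm

lemma hasDerivAt_scaledState (hu : ∀ a b, IntervalIntegrable u volume a b) (t : ℝ) :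
    HasDerivAt (scaledState R₀ c u) (c * Real.exp (cumulControl u t)) t := by
  have hc : Continuous fun s => Real.exp (cumulControl u s) := (continuous_cumulControl hu).rexp
  exact ((hc.integral_hasStrictDerivAt 0 t).hasDerivAt.const_mul c).const_add R₀

lemma hasDerivAt_scaledCostate (hu : ∀ a b, IntervalIntegrable u volume a b) (t : ℝ) :
    HasDerivAt (scaledCostate α T u) (-(α * Real.exp (-cumulControl u t))) t := by
  have hc : Continuous fun s => Real.exp (-cumulControl u s) :=
    (continuous_cumulControl hu).neg.rexp
  have := (intervalIntegral.integral_hasDerivAt_left (hc.intervalIntegrable t T)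
    (hc.stronglyMeasurableAtFilter _ _) hc.continuousAt).const_mul α
  simpa [scaledCostate] using! this

lemma continuous_scaledState (hu : ∀ a b, IntervalIntegrable u volume a b) :
    Continuous (scaledState R₀ c u) :=
  continuous_iff_continuousAt.2 fun t => (hasDerivAt_scaledState hu t).continuousAt

lemma continuous_scaledCostate (hu : ∀ a b, IntervalIntegrable u volume a b) :
    Continuous (scaledCostate α T u) :=
  continuous_iff_continuousAt.2 fun t => (hasDerivAt_scaledCostate hu t).continuousAt

lemma continuous_switchingFun (hu : ∀ a b, IntervalIntegrable u volume a b) :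
    Continuous (switchingFun α β c T R₀ u) :=
  continuous_const.sub ((continuous_scaledCostate hu).mul (continuous_scaledState hu))

lemma hasDerivAt_switchingFun (hu : ∀ a b, IntervalIntegrable u volume a b) (t : ℝ) :
    HasDerivAt (switchingFun α β c T R₀ u)
      (α * Real.exp (-cumulControl u t) * scaledState R₀ c u t -
        c * Real.exp (cumulControl u t) * scaledCostate α T u t) t := by
  convert! ((hasDerivAt_scaledCostate (α := α) (T := T) hu t).mul
    (hasDerivAt_scaledState (R₀ := R₀) (c := c) hu t)).const_sub β using 1
  ring

lemma Kstate_eq_s16 (hu : ∀ a b, IntervalIntegrable u volume a b) (t : ℝ) :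
    Kstate R₀ c u t = Real.exp (-cumulControl u t) * scaledState R₀ c u t := by
  have h1 : ∀ s, Real.exp (-(∫ ξ in s..t, u ξ))
      = Real.exp (-cumulControl u t) * Real.exp (cumulControl u s) := fun s => by
    rw [integral_eq_cumulControl_sub hu, ← Real.exp_add]; ring_nf
  have h0 : cumulControl u 0 = 0 := intervalIntegral.integral_same
  simp only [Kstate, scaledState, h1, intervalIntegral.integral_const_mul, h0, Real.exp_zero]
  ring

lemma continuous_Kstate (hu : ∀ a b, IntervalIntegrable u volume a b) :
    Continuous (Kstate R₀ c u) := by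
  rw [funext (Kstate_eq_s16 hu)]
  exact (continuous_cumulControl hu).neg.rexp.mul (continuous_scaledState hu)

/-- Integration by parts of a `C¹` function against a merely integrable one. -/
lemma integral_mul_eq_sub_of_hasDerivAt {F f g : ℝ → ℝ} {a b : ℝ}
    (hF : ∀ x, HasDerivAt F (f x) x) (hf : Continuous f) (hg : IntervalIntegrable g volume a b) :
    ∫ x in a..b, F x * g x
      = F b * (∫ y in a..b, g y) - ∫ x in a..b, f x * ∫ y in a..x, g y := by
  have hd : deriv F = f := funext fun x => (hF x).deriv
  have hF1 : ContDiff ℝ 1 F := contDiff_one_iff_deriv.2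
    ⟨fun x => (hF x).differentiableAt, hd ▸ hf⟩
  have key := (hF1.contDiffOn (s := Set.uIcc a b)).absolutelyContinuousOnInterval
    |>.integral_mul_deriv_eq_deriv_mul
      (hg.absolutelyContinuousOnInterval_intervalIntegral (c := a) (by simp))
  simp only [intervalIntegral.integral_same, mul_zero, sub_zero, hd] at key
  rw [← key]
  apply intervalIntegral.integral_congr_ae
  filter_upwards [hg.ae_hasDerivAt_integral] with x hx hx'
  rw [(hx (Set.uIoc_subset_uIcc hx') a (by simp)).deriv]

lemma integral_le_sub_add_of_le {F A B : ℝ → ℝ} {ε K t : ℝ} (ht : 0 ≤ t) (hF : Continuous F)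
    (hA : Continuous A) (hB : Continuous B)
    (hle : ∀ s ∈ Set.Icc 0 t, F s ≤ A s - ε * B s + K) :
    ∫ s in (0:ℝ)..t, F s ≤ (∫ s in (0:ℝ)..t, A s) - ε * (∫ s in (0:ℝ)..t, B s) + t * K := by
  have hAi := hA.intervalIntegrable (μ := volume) 0 t
  have hBi := (hB.intervalIntegrable (μ := volume) 0 t).const_mul ε
  calc ∫ s in (0:ℝ)..t, F s ≤ ∫ s in (0:ℝ)..t, (A s - ε * B s + K) :=
        intervalIntegral.integral_mono_on ht (hF.intervalIntegrable _ _)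
          ((hAi.sub hBi).add intervalIntegrable_const) hle
    _ = _ := by
        rw [intervalIntegral.integral_add (hAi.sub hBi) intervalIntegrable_const,
          intervalIntegral.integral_sub hAi hBi, intervalIntegral.integral_const_mul,
          intervalIntegral.integral_const, smul_eq_mul, sub_zero]

lemma exp_neg_add_le {a b N ε : ℝ} (ha : 0 ≤ a) (hb : |b| ≤ N) (hε : 0 ≤ ε) (hN : ε * N ≤ 1) :
    Real.exp (-(a + ε * b)) ≤ Real.exp (-a) - ε * (Real.exp (-a) * b) + ε ^ 2 * N ^ 2 := by
  have hN0 : 0 ≤ N := (abs_nonneg b).trans hb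
  have h1 : |-(ε * b)| ≤ ε * N := by
    rw [abs_neg, abs_mul, abs_of_nonneg hε]; gcongr
  have h2 := (abs_le.1 (Real.abs_exp_sub_one_sub_id_le (h1.trans hN))).2
  have h3 : (-(ε * b)) ^ 2 ≤ ε ^ 2 * N ^ 2 := by
    rw [← mul_pow, ← sq_abs]; gcongr
  have h4 : Real.exp (-a) ≤ 1 := Real.exp_le_one_iff.2 (by linarith)
  have h5 := Real.exp_pos (-a)
  rw [neg_add, Real.exp_add]
  nlinarith [mul_nonneg (sq_nonneg ε) (sq_nonneg N)]

/-- First-order expansion of the state under a perturbation of the control, with a quadratic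
remainder. -/
lemma Kstate_add_le (hu : ∀ a b, IntervalIntegrable u volume a b)
    (hh : ∀ a b, IntervalIntegrable h volume a b) (hu0 : ∀ t, 0 ≤ u t) {M ε t : ℝ}
    (hM : ∀ t, |h t| ≤ M) (hc : 0 ≤ c) (hR₀ : 0 ≤ R₀) (hε : 0 ≤ ε)
    (hεM : ε * (M * T) ≤ 1) (ht : t ∈ Set.Icc 0 T) :
    Kstate R₀ c (fun t => u t + ε * h t) t ≤ Kstate R₀ c u t
      - ε * (Real.exp (-cumulControl u t) * ∫ s in (0:ℝ)..t, scaledState R₀ c u s * h s)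
      + ε ^ 2 * ((M * T) ^ 2 * (R₀ + c * T)) := by
  obtain ⟨ht0, htT⟩ := ht
  have hM0 : 0 ≤ M := (abs_nonneg _).trans (hM 0)
  have hbound : ∀ s ∈ Set.Icc 0 t, Real.exp (-(∫ ξ in s..t, (u ξ + ε * h ξ))) ≤
      Real.exp (-(∫ ξ in s..t, u ξ)) - ε * (Real.exp (-(∫ ξ in s..t, u ξ)) * ∫ ξ in s..t, h ξ)
        + ε ^ 2 * (M * T) ^ 2 := by
    intro s hs
    rw [intervalIntegral.integral_add (hu s t) ((hh s t).const_mul ε),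
      intervalIntegral.integral_const_mul]
    refine exp_neg_add_le (intervalIntegral.integral_nonneg hs.2 fun x _ => hu0 x) ?_ hε hεM
    have := intervalIntegral.norm_integral_le_of_norm_le_const (a := s) (b := t) (f := h) (C := M)
      fun x _ => hM x
    refine this.trans ?_
    rw [abs_of_nonneg (by linarith [hs.2])]
    gcongr
    linarith [hs.1]
  have hcU := continuous_cumulControl hu
  have hcH := continuous_cumulControl hh
  have hprim : ∀ (v : ℝ → ℝ), (∀ a b, IntervalIntegrable v volume a b) →
      Continuous fun s => ∫ ξ in s..t, v ξ := fun v hv => by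
    simp only [integral_eq_cumulControl_sub hv]
    exact continuous_const.sub (continuous_cumulControl hv)
  have hR := mul_le_mul_of_nonneg_left (hbound 0 ⟨le_rfl, ht0⟩) hR₀
  have hcE : Continuous fun s => Real.exp (-(∫ ξ in s..t, u ξ)) := (hprim u hu).neg.rexp
  have hcEh : Continuous fun s => Real.exp (-(∫ ξ in s..t, u ξ)) * ∫ ξ in s..t, h ξ :=
    hcE.mul (hprim h hh)
  have hcEv : Continuous fun s => Real.exp (-(∫ ξ in s..t, (u ξ + ε * h ξ))) :=
    (hprim _ fun a b => (hu a b).add ((hh a b).const_mul ε)).neg.rexp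
  have hC := mul_le_mul_of_nonneg_left (integral_le_sub_add_of_le ht0 hcEv hcE hcEh hbound) hc
  have hparts := integral_mul_eq_sub_of_hasDerivAt (a := 0) (b := t)
    (fun x => hasDerivAt_scaledState (R₀ := R₀) (c := c) hu x)
    (continuous_const.mul hcU.rexp) (hh 0 t)
  have hcexp : Continuous fun s => Real.exp (cumulControl u s) := hcU.rexp
  have hcexpH : Continuous fun s => Real.exp (cumulControl u s) * cumulControl h s :=
    hcexp.mul hcH
  have hsplit : ∫ s in (0:ℝ)..t, Real.exp (-(∫ ξ in s..t, u ξ)) * ∫ ξ in s..t, h ξ =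
      Real.exp (-cumulControl u t) * (cumulControl h t *
        (∫ s in (0:ℝ)..t, Real.exp (cumulControl u s)) -
          ∫ s in (0:ℝ)..t, Real.exp (cumulControl u s) * cumulControl h s) := by
    rw [← intervalIntegral.integral_const_mul, ← intervalIntegral.integral_sub
      ((hcexp.const_mul _).intervalIntegrable _ _)
      (hcexpH.intervalIntegrable _ _), ← intervalIntegral.integral_const_mul]
    refine intervalIntegral.integral_congr fun s _ => ?_
    simp only [integral_eq_cumulControl_sub hu, integral_eq_cumulControl_sub hh]
    rw [neg_sub, sub_eq_add_neg, Real.exp_add]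
    ring
  have hY : ∫ s in (0:ℝ)..t, c * Real.exp (cumulControl u s) * ∫ y in (0:ℝ)..s, h y =
      c * ∫ s in (0:ℝ)..t, Real.exp (cumulControl u s) * cumulControl h s := by
    rw [← intervalIntegral.integral_const_mul]
    simp only [cumulControl, mul_assoc]
  have hfirst : R₀ * (Real.exp (-(∫ ξ in (0:ℝ)..t, u ξ)) * ∫ ξ in (0:ℝ)..t, h ξ) +
      c * (∫ s in (0:ℝ)..t, Real.exp (-(∫ ξ in s..t, u ξ)) * ∫ ξ in s..t, h ξ) =
      Real.exp (-cumulControl u t) * ∫ s in (0:ℝ)..t, scaledState R₀ c u s * h s := by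
    rw [hparts, hY, hsplit, scaledState]
    change R₀ * (Real.exp (-cumulControl u t) * cumulControl h t) + _ =
      _ * ((R₀ + _) * cumulControl h t - _)
    ring
  rw [← hfirst]
  have hrem : c * (t * (ε ^ 2 * (M * T) ^ 2)) ≤ c * (T * (ε ^ 2 * (M * T) ^ 2)) := by gcongr
  simp only [Kstate]
  linarith

/-- First-order expansion of the cost under a perturbation of the control, with a quadratic
remainder. -/
lemma Jcost_add_le (hu : ∀ a b, IntervalIntegrable u volume a b)
    (hh : ∀ a b, IntervalIntegrable h volume a b) (hu0 : ∀ t, 0 ≤ u t) {M ε : ℝ}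
    (hM : ∀ t, |h t| ≤ M) (hα : 0 ≤ α) (hc : 0 ≤ c) (hR₀ : 0 ≤ R₀) (hT : 0 ≤ T) (hε : 0 ≤ ε)
    (hεM : ε * (M * T) ≤ 1) :
    Jcost α β c T R₀ (fun t => u t + ε * h t) ≤ Jcost α β c T R₀ u
      + ε * (∫ t in (0:ℝ)..T, switchingFun α β c T R₀ u t * h t)
      + ε ^ 2 * (α * T * ((M * T) ^ 2 * (R₀ + c * T))) := by
  have hv : ∀ a b, IntervalIntegrable (fun t => u t + ε * h t) volume a b :=
    fun a b => (hu a b).add ((hh a b).const_mul ε)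
  have hcZ : Continuous fun t => ∫ s in (0:ℝ)..t, scaledState R₀ c u s * h s :=
    intervalIntegral.continuous_primitive
      (fun a b => (hh a b).continuousOn_mul (continuous_scaledState hu).continuousOn) 0
  have hcD : Continuous fun t =>
      Real.exp (-cumulControl u t) * ∫ s in (0:ℝ)..t, scaledState R₀ c u s * h s :=
    (continuous_cumulControl hu).neg.rexp.mul hcZ
  have hK := integral_le_sub_add_of_le hT (continuous_Kstate hv) (continuous_Kstate hu) hcD
    fun t ht => Kstate_add_le hu hh hu0 hM hc hR₀ hε hεM ht
  have hparts := integral_mul_eq_sub_of_hasDerivAt (a := 0) (b := T)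
    (fun x => hasDerivAt_scaledCostate (α := α) (T := T) hu x)
    ((continuous_cumulControl hu).neg.rexp.const_mul α).neg
    ((hh 0 T).continuousOn_mul (continuous_scaledState (R₀ := R₀) (c := c) hu).continuousOn)
  have hP : scaledCostate α T u T = 0 := by simp [scaledCostate]
  simp only [hP, zero_mul, zero_sub, neg_mul, intervalIntegral.integral_neg, neg_neg, mul_assoc,
    intervalIntegral.integral_const_mul] at hparts
  have hgrad : ∫ t in (0:ℝ)..T, switchingFun α β c T R₀ u t * h t = β * (∫ t in (0:ℝ)..T, h t) -
      ∫ t in (0:ℝ)..T, scaledCostate α T u t * (scaledState R₀ c u t * h t) := by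
    rw [← intervalIntegral.integral_const_mul, ← intervalIntegral.integral_sub
      ((hh 0 T).const_mul β) (((hh 0 T).continuousOn_mul
        (continuous_scaledState hu).continuousOn).continuousOn_mul
        (continuous_scaledCostate hu).continuousOn)]
    refine intervalIntegral.integral_congr fun s _ => ?_
    simp only [switchingFun]
    ring
  have hJ : ∀ v : ℝ → ℝ, (∀ a b, IntervalIntegrable v volume a b) → Jcost α β c T R₀ v =
      α * (∫ t in (0:ℝ)..T, Kstate R₀ c v t) + β * ∫ t in (0:ℝ)..T, v t := fun v hv => by
    rw [Jcost, intervalIntegral.integral_add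
      (((continuous_Kstate hv).const_mul α).intervalIntegrable _ _) ((hv 0 T).const_mul β),
      intervalIntegral.integral_const_mul, intervalIntegral.integral_const_mul]
  rw [hJ _ hv, hJ _ hu, hgrad, hparts, intervalIntegral.integral_add (hu 0 T)
    ((hh 0 T).const_mul ε), intervalIntegral.integral_const_mul]
  have := mul_le_mul_of_nonneg_left hK hα
  linarith

end Basic

section Optimality

variable {α β c u₁ T R₀ : ℝ} {u : ℝ → ℝ}

lemma intervalIntegrable_of_mem_Icc (hm : Measurable u) (hb : ∀ t, u t ∈ Set.Icc 0 u₁) (a b : ℝ) :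
    IntervalIntegrable u volume a b := by
  refine (intervalIntegrable_const (c := u₁)).mono_fun hm.aestronglyMeasurable
    (Filter.Eventually.of_forall fun t => ?_)
  simp only [Real.norm_of_nonneg (hb t).1]
  exact (hb t).2.trans (le_abs_self u₁)

lemma nonneg_of_forall_small {D C δ : ℝ} (hC : 0 ≤ C) (hδ : 0 < δ)
    (hD : ∀ ε, 0 < ε → ε ≤ δ → 0 ≤ ε * D + ε ^ 2 * C) : 0 ≤ D := by
  by_contra! hneg
  have h1 : 0 < -D / (2 * (C + 1)) := by apply div_pos <;> linarith
  set ε := min δ (-D / (2 * (C + 1))) with hε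
  have hε0 : 0 < ε := lt_min hδ h1
  have h2 := hD ε hε0 (min_le_left _ _)
  have h3 : ε * (2 * (C + 1)) ≤ -D := (le_div_iff₀ (by linarith)).1 (min_le_right _ _)
  have h4 : 0 ≤ D + ε * C := by
    refine nonneg_of_mul_nonneg_right (a := ε) ?_ hε0
    linarith
  nlinarith

/-- The pointwise minimum condition: an optimal control is extremal wherever the switching function
does not vanish. -/
lemma ae_extremal_of_optimal (hα : 0 ≤ α) (hc : 0 ≤ c) (hu₁ : 0 < u₁) (hT : 0 < T) (hR₀ : 0 ≤ R₀)
    (hm : Measurable u) (hb : ∀ t, u t ∈ Set.Icc 0 u₁)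
    (hopt : ∀ v : ℝ → ℝ, Measurable v → (∀ t, v t ∈ Set.Icc 0 u₁) →
      Jcost α β c T R₀ u ≤ Jcost α β c T R₀ v) :
    ∀ᵐ t, t ∈ Set.Ioc 0 T → (0 < switchingFun α β c T R₀ u t → u t = 0) ∧
      (switchingFun α β c T R₀ u t < 0 → u t = u₁) := by
  classical
  have hu := intervalIntegrable_of_mem_Icc hm hb
  set φ := switchingFun α β c T R₀ u with hφ
  have hφc : Continuous φ := continuous_switchingFun hu
  let w : ℝ → ℝ := fun t => if 0 < φ t then 0 else if φ t < 0 then u₁ else u t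
  have hwm : Measurable w :=
    Measurable.ite (measurableSet_lt measurable_const hφc.measurable) measurable_const
      (Measurable.ite (measurableSet_lt hφc.measurable measurable_const) measurable_const hm)
  have hwb : ∀ t, w t ∈ Set.Icc 0 u₁ := fun t => by
    have := hb t
    simp only [w]
    split_ifs
    · exact ⟨le_rfl, hu₁.le⟩
    · exact ⟨hu₁.le, le_rfl⟩
    · exact this
  have hw := intervalIntegrable_of_mem_Icc hwm hwb
  have hh : ∀ a b, IntervalIntegrable (fun t => w t - u t) volume a b :=
    fun a b => (hw a b).sub (hu a b)
  have hM : ∀ t, |w t - u t| ≤ u₁ := fun t => by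
    obtain ⟨h1, h2⟩ := hb t
    obtain ⟨h3, h4⟩ := hwb t
    exact abs_le.2 ⟨by linarith, by linarith⟩
  have hle : ∀ t, φ t * (w t - u t) ≤ 0 := fun t => by
    obtain ⟨h1, h2⟩ := hb t
    simp only [w]
    split_ifs with h3 h4
    · nlinarith
    · nlinarith
    · simp
  have hD : 0 ≤ ∫ t in (0:ℝ)..T, φ t * (w t - u t) := by
    have hu₁T : 0 < u₁ * T := mul_pos hu₁ hT
    refine nonneg_of_forall_small (C := α * T * ((u₁ * T) ^ 2 * (R₀ + c * T)))
      (δ := min 1 (1 / (u₁ * T))) (by positivity) (by positivity) fun ε hε0 hε => ?_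
    have h1 : ε * (u₁ * T) ≤ 1 := (le_div_iff₀ hu₁T).1 (hε.trans (min_le_right _ _))
    have h2 : ε ≤ 1 := hε.trans (min_le_left _ _)
    have h3 := Jcost_add_le (β := β) hu hh (fun t => (hb t).1) hM hα hc hR₀ hT.le hε0.le h1
    have h4 := hopt (fun t => u t + ε * (w t - u t)) (hm.add ((hwm.sub hm).const_mul ε))
      fun t => by
        obtain ⟨h5, h6⟩ := hb t
        obtain ⟨h7, h8⟩ := hwb t
        constructor <;> nlinarith
    linarith
  have hprim : IntervalIntegrable (fun t => -(φ t * (w t - u t))) volume 0 T :=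
    ((hh 0 T).continuousOn_mul hφc.continuousOn).neg
  have hzero : ∫ t in (0:ℝ)..T, -(φ t * (w t - u t)) = 0 := by
    refine le_antisymm ?_
      (intervalIntegral.integral_nonneg hT.le fun t _ => neg_nonneg.2 (hle t))
    rw [intervalIntegral.integral_neg]
    linarith
  rw [intervalIntegral.integral_eq_zero_iff_of_le_of_nonneg_ae hT.le
    (Filter.Eventually.of_forall fun t => neg_nonneg.2 (hle t)) hprim,
    Filter.EventuallyEq, ae_restrict_iff' measurableSet_Ioc] at hzero
  filter_upwards [hzero] with t ht htT
  have h0 : φ t * (w t - u t) = 0 := neg_eq_zero.1 (ht htT)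
  refine ⟨fun hp => ?_, fun hn => ?_⟩
  · have h1 : w t = 0 := if_pos hp
    have h2 := (mul_eq_zero.1 h0).resolve_left hp.ne'
    linarith
  · have h1 : w t = u₁ := by simp only [w, if_neg hn.not_gt, if_pos hn]
    have h2 := (mul_eq_zero.1 h0).resolve_left hn.ne
    linarith

end Optimality

section Arcs

variable {α β c u₁ T R₀ : ℝ} {u : ℝ → ℝ}

lemma scaledState_nonneg (hc : 0 ≤ c) (hR₀ : 0 ≤ R₀)
    {t : ℝ} (ht : 0 ≤ t) : 0 ≤ scaledState R₀ c u t :=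
  add_nonneg hR₀ (mul_nonneg hc
    (intervalIntegral.integral_nonneg ht fun _ _ => (Real.exp_pos _).le))

lemma cumulControl_eq_of_ae_eq (hu : ∀ a b, IntervalIntegrable u volume a b) {a b w t : ℝ}
    (huw : ∀ᵐ s, s ∈ Set.Ioo a b → u s = w) (ht : t ∈ Set.Ico a b) :
    cumulControl u t = cumulControl u a + w * (t - a) := by
  have h1 : ∫ s in a..t, u s = ∫ _ in a..t, w := by
    apply intervalIntegral.integral_congr_ae
    filter_upwards [huw] with s hs hst
    rw [Set.uIoc_of_le ht.1] at hst
    exact hs ⟨hst.1, hst.2.trans_lt ht.2⟩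
  rw [integral_eq_cumulControl_sub hu, intervalIntegral.integral_const, smul_eq_mul] at h1
  linarith

/-- The switching function is convex along an arc where the control vanishes, so it cannot be
positive between two zeros. -/
lemma not_pos_between_zeros (hu : ∀ a b, IntervalIntegrable u volume a b) (hα : 0 ≤ α)
    (hc : 0 ≤ c) {a b : ℝ} (hab : a < b) (ha : switchingFun α β c T R₀ u a = 0)
    (hb : switchingFun α β c T R₀ u b = 0)
    (hpos : ∀ t ∈ Set.Ioo a b, 0 < switchingFun α β c T R₀ u t)
    (hzero : ∀ᵐ t, t ∈ Set.Ioo a b → u t = 0) : False := by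
  have hY : Monotone (scaledState R₀ c u) :=
    monotone_of_hasDerivAt_nonneg (hasDerivAt_scaledState hu) fun t =>
      mul_nonneg hc (Real.exp_pos _).le
  have hP : Antitone (scaledCostate α T u) :=
    antitone_of_hasDerivAt_nonpos (hasDerivAt_scaledCostate hu) fun t =>
      neg_nonpos.2 (mul_nonneg hα (Real.exp_pos _).le)
  have hconv : ConvexOn ℝ (Set.Icc a b) (switchingFun α β c T R₀ u) := by
    refine MonotoneOn.convexOn_of_deriv (convex_Icc a b) (continuous_switchingFun hu).continuousOn
      (fun t _ => (hasDerivAt_switchingFun hu t).differentiableAt.differentiableWithinAt) ?_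
    rw [interior_Icc]
    intro s hs t ht hst
    rw [(hasDerivAt_switchingFun hu s).deriv, (hasDerivAt_switchingFun hu t).deriv,
      cumulControl_eq_of_ae_eq hu hzero (Set.Ioo_subset_Ico_self hs),
      cumulControl_eq_of_ae_eq hu hzero (Set.Ioo_subset_Ico_self ht)]
    simp only [zero_mul, add_zero]
    have := hY hst
    have := hP hst
    gcongr
  have hmid : (a + b) / 2 ∈ Set.Ioo a b := ⟨by linarith, by linarith⟩
  have := hconv.le_max_of_mem_Icc (Set.left_mem_Icc.2 hab.le) (Set.right_mem_Icc.2 hab.le)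
    (Set.Ioo_subset_Icc_self hmid)
  rw [ha, hb, max_self] at this
  exact absurd (hpos _ hmid) this.not_gt

/-- In the singular case the switching function is concave along an arc where it is negative and
the control is maximal, so it cannot be negative between two zeros. -/
lemma not_neg_between_zeros (hu : ∀ a b, IntervalIntegrable u volume a b) (hα : 0 < α)
    (hβ : 0 < β) (hc : 0 < c) (hu₁ : 0 < u₁) (hR₀ : 0 ≤ R₀) (hs : √(α * c / β) ≤ u₁)
    {a b : ℝ} (ha0 : 0 ≤ a) (hab : a < b) (ha : switchingFun α β c T R₀ u a = 0)
    (hb : switchingFun α β c T R₀ u b = 0)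
    (hneg : ∀ t ∈ Set.Ioo a b, switchingFun α β c T R₀ u t < 0)
    (hmax : ∀ᵐ t, t ∈ Set.Ioo a b → u t = u₁) : False := by
  have hconc : ConcaveOn ℝ (Set.Icc a b) (switchingFun α β c T R₀ u) := by
    refine AntitoneOn.concaveOn_of_deriv (convex_Icc a b)
      (continuous_switchingFun hu).continuousOn
      (fun t _ => (hasDerivAt_switchingFun hu t).differentiableAt.differentiableWithinAt) ?_
    have hderiv : deriv (switchingFun α β c T R₀ u) = fun t =>
        α * Real.exp (-cumulControl u t) * scaledState R₀ c u t -
          c * Real.exp (cumulControl u t) * scaledCostate α T u t :=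
      funext fun t => (hasDerivAt_switchingFun hu t).deriv
    rw [interior_Icc, hderiv]
    have hder : ∀ t ∈ Set.Ioo a b, HasDerivAt
        (fun t => α * Real.exp (-cumulControl u t) * scaledState R₀ c u t -
          c * Real.exp (cumulControl u t) * scaledCostate α T u t)
        (2 * (α * c) - u₁ * (α * Real.exp (-cumulControl u t) * scaledState R₀ c u t +
          c * Real.exp (cumulControl u t) * scaledCostate α T u t)) t := by
      intro t ht
      have hU : HasDerivAt (cumulControl u) u₁ t := by
        have h1 : HasDerivAt (fun s => cumulControl u a + u₁ * (s - a)) u₁ t := by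
          simpa using (((hasDerivAt_id t).sub_const a).const_mul u₁).const_add (cumulControl u a)
        refine h1.congr_of_eventuallyEq ?_
        filter_upwards [Ioo_mem_nhds ht.1 ht.2] with s hs
        exact cumulControl_eq_of_ae_eq hu hmax (Set.Ioo_subset_Ico_self hs)
      convert! ((hU.neg.exp.const_mul α).mul (hasDerivAt_scaledState (R₀ := R₀) (c := c) hu t)).sub
        ((hU.exp.const_mul c).mul (hasDerivAt_scaledCostate (α := α) (T := T) hu t)) using 1
      have h2 : Real.exp (-cumulControl u t) * Real.exp (cumulControl u t) = 1 := by
        rw [← Real.exp_add]; simp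
      simp only [Pi.neg_apply]
      linear_combination (-2 * α * c) * h2
    refine antitoneOn_of_deriv_nonpos (convex_Ioo a b)
      (fun t ht => (hder t ht).continuousAt.continuousWithinAt) ?_ ?_
    · rw [interior_Ioo]
      exact fun t ht => (hder t ht).differentiableAt.differentiableWithinAt
    · rw [interior_Ioo]
      intro t ht
      rw [(hder t ht).deriv]
      have hY := scaledState_nonneg (R₀ := R₀) (u := u) hc.le hR₀ (ha0.trans ht.1.le)
      have hPY : β < scaledCostate α T u t * scaledState R₀ c u t := by
        have := hneg t ht
        unfold switchingFun at this
        linarith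
      have hP : 0 < scaledCostate α T u t := pos_of_mul_pos_left (hβ.trans hPY) hY
      set x := α * Real.exp (-cumulControl u t) * scaledState R₀ c u t with hx
      set y := c * Real.exp (cumulControl u t) * scaledCostate α T u t with hy
      have hx0 : 0 ≤ x := by positivity
      have hy0 : 0 ≤ y := by positivity
      have h2 : Real.exp (-cumulControl u t) * Real.exp (cumulControl u t) = 1 := by
        rw [← Real.exp_add]; simp
      have hxy : x * y = α * c * (scaledCostate α T u t * scaledState R₀ c u t) := by
        linear_combination (α * c * scaledCostate α T u t * scaledState R₀ c u t) * h2
      have hsq : α * c ≤ u₁ ^ 2 * β := by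
        have := (Real.sqrt_le_left hu₁.le).1 hs
        exact (div_le_iff₀ hβ).1 this
      have h3 : α * c * β ≤ x * y := by rw [hxy]; gcongr
      have h4 : (2 * (α * c)) ^ 2 ≤ (u₁ * (x + y)) ^ 2 := by
        calc (2 * (α * c)) ^ 2 = 4 * (α * c) * (α * c) := by ring
          _ ≤ 4 * (α * c) * (u₁ ^ 2 * β) := by gcongr
          _ = 4 * u₁ ^ 2 * (α * c * β) := by ring
          _ ≤ 4 * u₁ ^ 2 * (x * y) := by gcongr
          _ ≤ (u₁ * (x + y)) ^ 2 := by nlinarith [mul_nonneg (sq_nonneg u₁) (sq_nonneg (x - y))]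
      have := abs_le_of_sq_le_sq h4 (by positivity)
      linarith [le_abs_self (2 * (α * c))]
  have hmid : (a + b) / 2 ∈ Set.Ioo a b := ⟨by linarith, by linarith⟩
  have := hconc.min_le_of_mem_Icc (Set.left_mem_Icc.2 hab.le) (Set.right_mem_Icc.2 hab.le)
    (Set.Ioo_subset_Icc_self hmid)
  rw [ha, hb, min_self] at this
  exact absurd (hneg _ hmid) this.not_gt

/-- Along a singular arc, the control is almost everywhere equal to `√(αc/β)`. -/
lemma ae_eq_sqrt_of_switchingFun_eq_zero (hu : ∀ a b, IntervalIntegrable u volume a b)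
    (hα : 0 < α) (hβ : 0 < β) (hc : 0 < c) (hR₀ : 0 ≤ R₀) {a b : ℝ} (ha0 : 0 ≤ a)
    (hzero : ∀ t ∈ Set.Ioo a b, switchingFun α β c T R₀ u t = 0) :
    ∀ᵐ t, t ∈ Set.Ioo a b → u t = √(α * c / β) := by
  have hκ : 0 < √(α * c / β) := Real.sqrt_pos.2 (by positivity)
  have hκ2 : √(α * c / β) ^ 2 * β = α * c := by
    rw [Real.sq_sqrt (by positivity)]; field_simp
  set κ := √(α * c / β)
  have hstate : ∀ t ∈ Set.Ioo a b, κ * scaledState R₀ c u t = c * Real.exp (cumulControl u t) := by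
    intro t ht
    have hY := scaledState_nonneg (R₀ := R₀) (u := u) hc.le hR₀ (ha0.trans ht.1.le)
    have h1 : α * Real.exp (-cumulControl u t) * scaledState R₀ c u t -
        c * Real.exp (cumulControl u t) * scaledCostate α T u t = 0 := by
      have h0 : HasDerivAt (switchingFun α β c T R₀ u) 0 t := by
        refine (hasDerivAt_const t (0:ℝ)).congr_of_eventuallyEq ?_
        filter_upwards [Ioo_mem_nhds ht.1 ht.2] with s hs using hzero s hs
      exact (hasDerivAt_switchingFun hu t).unique h0
    have h2 : Real.exp (-cumulControl u t) * Real.exp (cumulControl u t) = 1 := by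
      rw [← Real.exp_add]; simp
    have h3 : scaledCostate α T u t * scaledState R₀ c u t = β := by
      have := hzero t ht
      unfold switchingFun at this
      linarith
    have h4 : α * scaledState R₀ c u t ^ 2 = c * Real.exp (cumulControl u t) ^ 2 * β := by
      rw [← h3]
      linear_combination (Real.exp (cumulControl u t) * scaledState R₀ c u t) * h1 -
        α * scaledState R₀ c u t ^ 2 * h2
    refine (pow_left_inj₀ (by positivity) (by positivity) two_ne_zero).1 ?_
    have h5 : α * β * ((κ * scaledState R₀ c u t) ^ 2) =
        α * β * ((c * Real.exp (cumulControl u t)) ^ 2) := by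
      linear_combination α * scaledState R₀ c u t ^ 2 * hκ2 + α * c * h4
    exact mul_left_cancel₀ (by positivity) h5
  filter_upwards [(hu 0 b).ae_hasDerivAt_integral] with t hder ht
  have ht0 : 0 ≤ t := ha0.trans ht.1.le
  have hder0 := hder (Set.uIcc_of_le (ht0.trans ht.2.le) ▸ ⟨ht0, ht.2.le⟩) 0 Set.left_mem_uIcc
  have hlog : HasDerivAt (cumulControl u)
      ((κ / c * (c * Real.exp (cumulControl u t))) / (κ / c * scaledState R₀ c u t)) t := by
    have hpos : κ / c * scaledState R₀ c u t ≠ 0 := by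
      have := hstate t ht
      rw [div_mul_eq_mul_div, this]
      positivity
    refine (((hasDerivAt_scaledState hu t).const_mul (κ / c)).log hpos).congr_of_eventuallyEq ?_
    filter_upwards [Ioo_mem_nhds ht.1 ht.2] with s hs
    rw [div_mul_eq_mul_div, hstate s hs, mul_div_cancel_left₀ _ hc.ne', Real.log_exp]
  rw [hder0.unique hlog, div_mul_eq_mul_div _ _ (scaledState R₀ c u t), hstate t ht]
  have := Real.exp_pos (cumulControl u t)
  field_simp

end Arcs

section SignStructure

lemma pos_or_neg_of_ne_zero {φ : ℝ → ℝ} {S : Set ℝ} (hφ : Continuous φ) (hS : IsPreconnected S)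
    (hne : ∀ t ∈ S, φ t ≠ 0) : (∀ t ∈ S, 0 < φ t) ∨ ∀ t ∈ S, φ t < 0 := by
  by_contra! h
  obtain ⟨⟨s, hs, hs0⟩, t, ht, ht0⟩ := h
  obtain ⟨x, hx, hx0⟩ := hS.intermediate_value hs ht hφ.continuousOn ⟨hs0, ht0⟩
  exact hne x hx hx0

/-- A continuous function that is positive at `T` and has no bounded component of its non-zero set
inside `[0, T]` has constant sign, then vanishes, then is positive. -/
lemma exists_sign_structure {φ : ℝ → ℝ} {T : ℝ} (hφ : Continuous φ) (hT : 0 < T) (hφT : 0 < φ T)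
    (hpos : ∀ a b, 0 ≤ a → a < b → b ≤ T → φ a = 0 → φ b = 0 → ¬ ∀ t ∈ Set.Ioo a b, 0 < φ t)
    (hneg : ∀ a b, 0 ≤ a → a < b → b ≤ T → φ a = 0 → φ b = 0 → ¬ ∀ t ∈ Set.Ioo a b, φ t < 0) :
    ∃ t₁ t₂, 0 ≤ t₁ ∧ t₁ ≤ t₂ ∧ t₂ ≤ T ∧
      ((∀ t ∈ Set.Ioo 0 t₁, 0 < φ t) ∨ ∀ t ∈ Set.Ioo 0 t₁, φ t < 0) ∧
      (∀ t ∈ Set.Ioo t₁ t₂, φ t = 0) ∧ ∀ t ∈ Set.Ioo t₂ T, 0 < φ t := by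
  have hcpt : ∀ a b, IsCompact (Set.Icc a b ∩ φ ⁻¹' {0}) := fun a b =>
    isCompact_Icc.inter_right (isClosed_singleton.preimage hφ)
  have htail : ∀ a, a < T → (∀ t ∈ Set.Ioc a T, φ t ≠ 0) → ∀ t ∈ Set.Ioo a T, 0 < φ t := by
    intro a haT hne t ht
    rcases pos_or_neg_of_ne_zero hφ isPreconnected_Ioc hne with h | h
    · exact h t (Set.Ioo_subset_Ioc_self ht)
    · exact absurd (h T ⟨haT, le_rfl⟩) hφT.not_gt
  rcases (Set.Icc 0 T ∩ φ ⁻¹' {0}).eq_empty_or_nonempty with hZ | hZ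
  · refine ⟨0, 0, le_rfl, le_rfl, hT.le, by simp, by simp, htail 0 hT fun t ht h0 => ?_⟩
    exact (Set.eq_empty_iff_forall_notMem.1 hZ) t ⟨⟨ht.1.le, ht.2⟩, h0⟩
  obtain ⟨⟨h10, h1T⟩, h1z⟩ := (hcpt 0 T).sInf_mem hZ
  obtain ⟨⟨h20, h2T⟩, h2z⟩ := (hcpt 0 T).sSup_mem hZ
  have hlow : ∀ t ∈ Set.Icc 0 T ∩ φ ⁻¹' {0}, sInf (Set.Icc 0 T ∩ φ ⁻¹' {0}) ≤ t :=
    fun t ht => csInf_le (hcpt 0 T).bddBelow ht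
  have hupp : ∀ t ∈ Set.Icc 0 T ∩ φ ⁻¹' {0}, t ≤ sSup (Set.Icc 0 T ∩ φ ⁻¹' {0}) :=
    fun t ht => le_csSup (hcpt 0 T).bddAbove ht
  set t₁ := sInf (Set.Icc 0 T ∩ φ ⁻¹' {0})
  set t₂ := sSup (Set.Icc 0 T ∩ φ ⁻¹' {0})
  have h2lt : t₂ < T := lt_of_le_of_ne h2T fun h => hφT.ne' (h ▸ h2z)
  refine ⟨t₁, t₂, h10, hlow _ ⟨⟨h20, h2T⟩, h2z⟩, h2T, ?_, ?_, ?_⟩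
  · refine pos_or_neg_of_ne_zero hφ isPreconnected_Ioo fun t ht h0 => ?_
    exact (hlow t ⟨⟨ht.1.le, ht.2.le.trans h1T⟩, h0⟩).not_gt ht.2
  · intro t ht
    by_contra hne
    obtain ⟨⟨ha1, hat⟩, haz⟩ := (hcpt t₁ t).sSup_mem ⟨t₁, ⟨le_rfl, ht.1.le⟩, h1z⟩
    obtain ⟨⟨hbt, hb2⟩, hbz⟩ := (hcpt t t₂).sInf_mem ⟨t₂, ⟨ht.2.le, le_rfl⟩, h2z⟩
    have hale : ∀ s ∈ Set.Icc t₁ t ∩ φ ⁻¹' {0}, s ≤ sSup (Set.Icc t₁ t ∩ φ ⁻¹' {0}) :=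
      fun s hs => le_csSup (hcpt t₁ t).bddAbove hs
    have hble : ∀ s ∈ Set.Icc t t₂ ∩ φ ⁻¹' {0}, sInf (Set.Icc t t₂ ∩ φ ⁻¹' {0}) ≤ s :=
      fun s hs => csInf_le (hcpt t t₂).bddBelow hs
    set a := sSup (Set.Icc t₁ t ∩ φ ⁻¹' {0})
    set b := sInf (Set.Icc t t₂ ∩ φ ⁻¹' {0})
    have hat' : a < t := lt_of_le_of_ne hat fun h => hne (h ▸ haz)
    have hsign := pos_or_neg_of_ne_zero hφ (isPreconnected_Ioo (a := a) (b := b)) fun s hs h0 => by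
      rcases le_total s t with hst | hst
      · exact (hale s ⟨⟨ha1.trans hs.1.le, hst⟩, h0⟩).not_gt hs.1
      · exact (hble s ⟨⟨hst, hs.2.le.trans hb2⟩, h0⟩).not_gt hs.2
    rcases hsign with h | h
    · exact hpos a b (h10.trans ha1) (hat'.trans_le hbt) (hb2.trans h2T) haz hbz h
    · exact hneg a b (h10.trans ha1) (hat'.trans_le hbt) (hb2.trans h2T) haz hbz h
  · refine htail t₂ h2lt fun t ht h0 => ?_
    exact (hupp t ⟨⟨h20.trans ht.1.le, ht.2⟩, h0⟩).not_gt ht.1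

end SignStructure

lemma integral_congr_of_ae_Icc {T a b : ℝ} {u v : ℝ → ℝ}
    (h : ∀ᵐ t, t ∈ Set.Icc 0 T → u t = v t) (ha : a ∈ Set.Icc 0 T) (hb : b ∈ Set.Icc 0 T) :
    ∫ t in a..b, u t = ∫ t in a..b, v t := by
  apply intervalIntegral.integral_congr_ae
  filter_upwards [h] with t ht htab
  exact ht (Set.uIcc_subset_Icc ha hb (Set.uIoc_subset_uIcc htab))

lemma Jcost_congr_ae {α β c T R₀ : ℝ} {u v : ℝ → ℝ} (hT : 0 ≤ T)
    (h : ∀ᵐ t, t ∈ Set.Icc 0 T → u t = v t) : Jcost α β c T R₀ u = Jcost α β c T R₀ v := by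
  have h0 : (0:ℝ) ∈ Set.Icc 0 T := ⟨le_rfl, hT⟩
  refine integral_congr_of_ae_Icc ?_ h0 ⟨hT, le_rfl⟩
  filter_upwards [h] with t ht htT
  have hK : Kstate R₀ c u t = Kstate R₀ c v t := by
    unfold Kstate
    rw [integral_congr_of_ae_Icc h h0 htT]
    congr 2
    refine intervalIntegral.integral_congr fun s hs => ?_
    simp only [integral_congr_of_ae_Icc h (Set.uIcc_subset_Icc h0 htT hs) htT]
  rw [hK, ht htT]

/-- Theorem 2: in the singular case `√(αc/β) ≤ u₁` with `R₀ ≥ 0`,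
any optimal control has the form `v → u_s → 0` with `v ∈ {0, u₁}` and
`u_s = √(αc/β)`, so the number of switchings does not exceed 2 and the optimal
solution may contain a singular arc. -/
theorem optimal_control_structure_singular (α β c u₁ T R₀ : ℝ)
    (hα : 0 < α) (hβ : 0 < β) (hc : 0 < c) (hu₁ : 0 < u₁) (hT : 0 < T)
    (hR₀ : 0 ≤ R₀) (hs : Real.sqrt (α * c / β) ≤ u₁)
    (uo : ℝ → ℝ) (huo : Admissible T u₁ uo)
    (hopt : ∀ u : ℝ → ℝ, Admissible T u₁ u → Jcost α β c T R₀ uo ≤ Jcost α β c T R₀ u) :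
    ∃ t₁ t₂ : ℝ, ∃ v ∈ ({0, u₁} : Set ℝ), 0 ≤ t₁ ∧ t₁ ≤ t₂ ∧ t₂ ≤ T ∧
      (∀ᵐ t ∂(volume.restrict (Set.Ioo (0:ℝ) t₁)), uo t = v) ∧
      (∀ᵐ t ∂(volume.restrict (Set.Ioo t₁ t₂)), uo t = Real.sqrt (α * c / β)) ∧
      (∀ᵐ t ∂(volume.restrict (Set.Ioo t₂ T)), uo t = 0) := by
  let u : ℝ → ℝ := fun t => max 0 (min (uo t) u₁)
  have hm : Measurable u := measurable_const.max (huo.1.min measurable_const)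
  have hb : ∀ t, u t ∈ Set.Icc 0 u₁ := fun t =>
    ⟨le_max_left _ _, max_le hu₁.le (min_le_right _ _)⟩
  have huuo : ∀ᵐ t, t ∈ Set.Icc 0 T → uo t = u t := by
    filter_upwards [(ae_restrict_iff' measurableSet_Icc).1 huo.2] with t ht htT
    obtain ⟨h1, h2⟩ := ht htT
    simp only [u, min_eq_left h2, max_eq_right h1]
  have hext := ae_extremal_of_optimal (β := β) hα.le hc.le hu₁ hT hR₀ hm hb fun v hvm hvb =>
    (Jcost_congr_ae hT.le huuo).symm.trans_le
      (hopt v ⟨hvm, Filter.Eventually.of_forall hvb⟩)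
  have hu := intervalIntegrable_of_mem_Icc hm hb
  have hpos : ∀ a b, 0 ≤ a → b ≤ T → (∀ t ∈ Set.Ioo a b, 0 < switchingFun α β c T R₀ u t) →
      ∀ᵐ t, t ∈ Set.Ioo a b → u t = 0 := fun a b ha0 hbT h => by
    filter_upwards [hext] with t ht htab
    exact (ht ⟨ha0.trans_lt htab.1, htab.2.le.trans hbT⟩).1 (h t htab)
  have hneg : ∀ a b, 0 ≤ a → b ≤ T → (∀ t ∈ Set.Ioo a b, switchingFun α β c T R₀ u t < 0) →
      ∀ᵐ t, t ∈ Set.Ioo a b → u t = u₁ := fun a b ha0 hbT h => by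
    filter_upwards [hext] with t ht htab
    exact (ht ⟨ha0.trans_lt htab.1, htab.2.le.trans hbT⟩).2 (h t htab)
  have hφT : 0 < switchingFun α β c T R₀ u T := by simpa [switchingFun, scaledCostate] using hβ
  obtain ⟨t₁, t₂, h0, h12, h2T, hfirst, hmid, hend⟩ :=
    exists_sign_structure (continuous_switchingFun hu) hT hφT
      (fun a b ha0 hab hbT ha hb h =>
        not_pos_between_zeros hu hα.le hc.le hab ha hb h (hpos a b ha0 hbT h))
      (fun a b ha0 hab hbT ha hb h =>
        not_neg_between_zeros hu hα hβ hc hu₁ hR₀ hs ha0 hab ha hb h (hneg a b ha0 hbT h))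
  have hback : ∀ {a b w : ℝ}, 0 ≤ a → b ≤ T → (∀ᵐ t, t ∈ Set.Ioo a b → u t = w) →
      ∀ᵐ t ∂(volume.restrict (Set.Ioo a b)), uo t = w := fun ha0 hbT h => by
    rw [ae_restrict_iff' measurableSet_Ioo]
    filter_upwards [h, huuo] with t ht htu htab
    rw [htu ⟨ha0.trans htab.1.le, htab.2.le.trans hbT⟩, ht htab]
  have hsing := hback h0 h2T (ae_eq_sqrt_of_switchingFun_eq_zero hu hα hβ hc hR₀ h0 hmid)
  have hfinal := hback (h0.trans h12) le_rfl (hpos t₂ T (h0.trans h12) le_rfl hend)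
  have h1T := h12.trans h2T
  rcases hfirst with h | h
  · exact ⟨t₁, t₂, 0, by simp, h0, h12, h2T, hback le_rfl h1T (hpos 0 t₁ le_rfl h1T h), hsing,
      hfinal⟩
  · exact ⟨t₁, t₂, u₁, by simp, h0, h12, h2T, hback le_rfl h1T (hneg 0 t₁ le_rfl h1T h), hsing,
      hfinal⟩
end

section
/- For every optimal solution, sending messages at times close to T is not optimal: if R₀ ≥ 0 and û is an admissible control minimizing J, then there exists τ ∈ [0, T) such that û(t) = 0 for almost every t ∈ (τ, T). -/
open MeasureTheory Real

theorem Admissible.intervalIntegrable {T u₁ : ℝ} {u : ℝ → ℝ} (hu : Admissible T u₁ u)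
    {a b : ℝ} (ha : a ∈ Set.Icc 0 T) (hb : b ∈ Set.Icc 0 T) :
    IntervalIntegrable u volume a b := by
  have h : IntegrableOn u (Set.Icc 0 T) volume := by
    refine Measure.integrableOn_of_bounded (M := u₁) (by simp) hu.1.aestronglyMeasurable ?_
    filter_upwards [hu.2] with t ht
    rw [Real.norm_of_nonneg ht.1]
    exact ht.2
  exact (h.mono_set (Set.uIcc_subset_Icc ha hb)).intervalIntegrable

theorem continuousOn_Kstate {R₀ c T : ℝ} {u : ℝ → ℝ} (hT : 0 ≤ T)
    (hu : ∀ a ∈ Set.Icc (0:ℝ) T, ∀ b ∈ Set.Icc (0:ℝ) T, IntervalIntegrable u volume a b) :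
    ContinuousOn (Kstate R₀ c u) (Set.Icc 0 T) := by
  have h0 : (0:ℝ) ∈ Set.Icc 0 T := ⟨le_rfl, hT⟩
  have hTT : T ∈ Set.Icc 0 T := ⟨hT, le_rfl⟩
  have hU : ContinuousOn (fun t => ∫ ξ in (0:ℝ)..t, u ξ) (Set.Icc 0 T) := by
    rw [← Set.uIcc_of_le hT]
    refine intervalIntegral.continuousOn_primitive_interval ?_
    rw [← intervalIntegrable_iff']
    exact hu 0 h0 T hTT
  have hE : ContinuousOn (fun t => ∫ s in (0:ℝ)..t, Real.exp (∫ ξ in (0:ℝ)..s, u ξ))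
      (Set.Icc 0 T) := by
    rw [← Set.uIcc_of_le hT] at hU ⊢
    refine intervalIntegral.continuousOn_primitive_interval ?_
    exact (Real.continuous_exp.comp_continuousOn hU).integrableOn_compact isCompact_uIcc
  have hexp := Real.continuous_exp.comp_continuousOn hU.neg
  refine ContinuousOn.congr ((hexp.const_mul R₀).add ((hexp.mul hE).const_mul c)) ?_
  intro t ht
  simp only [Kstate]
  congr 2
  rw [Pi.mul_apply, ← intervalIntegral.integral_const_mul]
  simp only [Function.comp_apply, Pi.neg_apply]
  refine intervalIntegral.integral_congr fun s hs => ?_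
  have hs' : s ∈ Set.Icc 0 T := Set.uIcc_subset_Icc h0 ht hs
  simp only [← Real.exp_add]
  rw [← intervalIntegral.integral_add_adjacent_intervals (hu 0 h0 s hs') (hu s hs' t ht)]
  congr 1
  ring

theorem exp_neg_le_exp_neg_add_sub {a b : ℝ} (ha : 0 ≤ a) (hab : a ≤ b) :
    Real.exp (-a) ≤ Real.exp (-b) + (b - a) := by
  have h1 : Real.exp (-b) = Real.exp (-a) * Real.exp (-(b - a)) := by
    rw [← Real.exp_add]; congr 1; ring
  have h2 := Real.add_one_le_exp (-(b - a))
  have h3 : Real.exp (-a) ≤ 1 := Real.exp_le_one_iff.2 (by linarith)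
  have h4 := Real.exp_pos (-a)
  nlinarith

theorem Kstate_le_Kstate_add {R₀ c T m : ℝ} {u v : ℝ → ℝ} (hR₀ : 0 ≤ R₀) (hc : 0 ≤ c)
    (hm : 0 ≤ m)
    (hu : ∀ a ∈ Set.Icc (0:ℝ) T, ∀ b ∈ Set.Icc (0:ℝ) T, IntervalIntegrable u volume a b)
    (hv : ∀ a ∈ Set.Icc (0:ℝ) T, ∀ b ∈ Set.Icc (0:ℝ) T, IntervalIntegrable v volume a b)
    (hvu : ∀ s t, 0 ≤ s → s ≤ t → t ≤ T → 0 ≤ ∫ ξ in s..t, v ξ ∧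
      ∫ ξ in s..t, v ξ ≤ ∫ ξ in s..t, u ξ ∧ ∫ ξ in s..t, u ξ ≤ (∫ ξ in s..t, v ξ) + m)
    {t : ℝ} (ht : t ∈ Set.Icc 0 T) :
    Kstate R₀ c v t ≤ Kstate R₀ c u t + (R₀ + c * T) * m := by
  have key : ∀ s ∈ Set.Icc 0 t,
      Real.exp (-(∫ ξ in s..t, v ξ)) ≤ Real.exp (-(∫ ξ in s..t, u ξ)) + m := by
    intro s hs
    obtain ⟨h1, h2, h3⟩ := hvu s t hs.1 hs.2 ht.2
    linarith [exp_neg_le_exp_neg_add_sub h1 h2]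
  have cont : ∀ w : ℝ → ℝ,
      (∀ a ∈ Set.Icc (0:ℝ) T, ∀ b ∈ Set.Icc (0:ℝ) T, IntervalIntegrable w volume a b) →
      IntervalIntegrable (fun s => Real.exp (-(∫ ξ in s..t, w ξ))) volume 0 t := by
    intro w hw
    have hwt := hw 0 ⟨le_rfl, ht.1.trans ht.2⟩ t ht
    rw [intervalIntegrable_iff'] at hwt
    exact (Real.continuous_exp.comp_continuousOn
      (intervalIntegral.continuousOn_primitive_interval_left hwt).neg).intervalIntegrable
  have hint := intervalIntegral.integral_mono_on ht.1 (cont v hv)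
    ((cont u hu).add (intervalIntegrable_const (c := m))) key
  rw [intervalIntegral.integral_add (cont u hu) intervalIntegrable_const,
    intervalIntegral.integral_const, smul_eq_mul, sub_zero] at hint
  have h0 := mul_le_mul_of_nonneg_left (key 0 ⟨le_rfl, ht.1⟩) hR₀
  have h1 := mul_le_mul_of_nonneg_left hint hc
  have h2 : c * (t * m) ≤ c * (T * m) := by gcongr; exact ht.2
  unfold Kstate
  linarith

/-- for every optimal control there is `τ ∈ [0,T)` such that the
control vanishes a.e. on `(τ, T)`: sending messages at times close to `T` is not optimal. -/
theorem optimal_control_vanishes_near_T (α β c u₁ T R₀ : ℝ)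
    (hα : 0 < α) (hβ : 0 < β) (hc : 0 < c) (hu₁ : 0 < u₁) (hT : 0 < T)
    (hR₀ : 0 ≤ R₀)
    (uo : ℝ → ℝ) (huo : Admissible T u₁ uo)
    (hopt : ∀ u : ℝ → ℝ, Admissible T u₁ u → Jcost α β c T R₀ uo ≤ Jcost α β c T R₀ u) :
    ∃ τ : ℝ, 0 ≤ τ ∧ τ < T ∧
      ∀ᵐ t ∂(volume.restrict (Set.Ioo τ T)), uo t = 0 := by
  obtain ⟨τ, hτ0, hτT, hτ⟩ : ∃ τ : ℝ, 0 ≤ τ ∧ τ < T ∧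
      α * ((R₀ + c * T) * (T - τ)) < β := by
    have hB : 0 < α * (R₀ + c * T) := by positivity
    have hB' : 0 < β / (2 * (α * (R₀ + c * T))) := by positivity
    refine ⟨max 0 (T - β / (2 * (α * (R₀ + c * T)))), le_max_left _ _, by simp [hT, hB'], ?_⟩
    have h1 : T - max 0 (T - β / (2 * (α * (R₀ + c * T)))) ≤ β / (2 * (α * (R₀ + c * T))) := by
      linarith [le_max_right 0 (T - β / (2 * (α * (R₀ + c * T))))]
    have h2 := mul_le_mul_of_nonneg_left h1 hB.le
    have h3 : α * (R₀ + c * T) * (β / (2 * (α * (R₀ + c * T)))) = β / 2 := by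
      field_simp
    linarith
  refine ⟨τ, hτ0, hτT, ?_⟩
  have m0 : (0:ℝ) ∈ Set.Icc 0 T := ⟨le_rfl, hT.le⟩
  have mτ : τ ∈ Set.Icc 0 T := ⟨hτ0, hτT.le⟩
  have mT : T ∈ Set.Icc 0 T := ⟨hT.le, le_rfl⟩
  set v : ℝ → ℝ := (Set.Iic τ).indicator uo with hv_def
  have hv : Admissible T u₁ v := by
    refine ⟨huo.1.indicator measurableSet_Iic, ?_⟩
    filter_upwards [huo.2] with t ht
    by_cases h : t ∈ Set.Iic τ
    · simpa [hv_def, h] using ht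
    · simp only [hv_def, Set.indicator_of_notMem h]
      exact ⟨le_rfl, hu₁.le⟩
  have hui := fun a (ha : a ∈ Set.Icc 0 T) b hb => huo.intervalIntegrable ha (b := b) hb
  have hvi := fun a (ha : a ∈ Set.Icc 0 T) b hb => hv.intervalIntegrable ha (b := b) hb
  have hnn : ∀ w, Admissible T u₁ w → ∀ s t, 0 ≤ s → s ≤ t → t ≤ T → 0 ≤ ∫ ξ in s..t, w ξ := by
    intro w hw s t hs hst ht
    refine intervalIntegral.integral_nonneg_of_ae_restrict hst ?_
    filter_upwards [ae_restrict_of_ae_restrict_of_subset (Set.Icc_subset_Icc hs ht) hw.2]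
      with x hx using hx.1
  have hv_eq : ∀ s t, s ≤ τ → t ≤ τ → ∫ ξ in s..t, v ξ = ∫ ξ in s..t, uo ξ := by
    intro s t hs ht
    refine intervalIntegral.integral_congr fun x hx => ?_
    exact Set.indicator_of_mem (show x ∈ Set.Iic τ from hx.2.trans (max_le hs ht)) uo
  have hv_zero : ∀ s t, τ ≤ s → τ ≤ t → ∫ ξ in s..t, v ξ = 0 := by
    intro s t hs ht
    refine intervalIntegral.integral_zero_ae (Filter.Eventually.of_forall fun x hx => ?_)
    exact Set.indicator_of_notMem
      (show x ∉ Set.Iic τ from not_le.2 ((le_min hs ht).trans_lt hx.1)) uo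
  set m := ∫ ξ in τ..T, uo ξ with hm_def
  have hm : 0 ≤ m := hnn uo huo τ T hτ0 hτT.le le_rfl
  have hle : ∀ s t, τ ≤ s → s ≤ t → t ≤ T → ∫ ξ in s..t, uo ξ ≤ m := by
    intro s t hs hst ht
    have ms : s ∈ Set.Icc 0 T := ⟨hτ0.trans hs, hst.trans ht⟩
    have mt : t ∈ Set.Icc 0 T := ⟨ms.1.trans hst, ht⟩
    rw [hm_def, ← intervalIntegral.integral_add_adjacent_intervals (hui τ mτ s ms) (hui s ms T mT),
      ← intervalIntegral.integral_add_adjacent_intervals (hui s ms t mt) (hui t mt T mT)]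
    linarith [hnn uo huo τ s hτ0 hs ms.2, hnn uo huo t T mt.1 ht le_rfl]
  have hvu : ∀ s t, 0 ≤ s → s ≤ t → t ≤ T → 0 ≤ ∫ ξ in s..t, v ξ ∧
      ∫ ξ in s..t, v ξ ≤ ∫ ξ in s..t, uo ξ ∧ ∫ ξ in s..t, uo ξ ≤ (∫ ξ in s..t, v ξ) + m := by
    intro s t hs hst ht
    refine ⟨hnn v hv s t hs hst ht, ?_⟩
    have ms : s ∈ Set.Icc 0 T := ⟨hs, hst.trans ht⟩
    have mt : t ∈ Set.Icc 0 T := ⟨hs.trans hst, ht⟩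
    rcases le_total t τ with h | h
    · rw [hv_eq s t (hst.trans h) h]
      exact ⟨le_rfl, by linarith⟩
    rcases le_total τ s with h' | h'
    · rw [hv_zero s t h' h]
      exact ⟨hnn uo huo s t hs hst ht, by linarith [hle s t h' hst ht]⟩
    · rw [← intervalIntegral.integral_add_adjacent_intervals (hui s ms τ mτ) (hui τ mτ t mt),
        ← intervalIntegral.integral_add_adjacent_intervals (hvi s ms τ mτ) (hvi τ mτ t mt),
        hv_eq s τ h' le_rfl, hv_zero τ t le_rfl h]
      constructor
      · linarith [hnn uo huo τ t hτ0 h ht]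
      · linarith [hle τ t le_rfl h ht]
  have hKi : ∀ w, Admissible T u₁ w → ∀ a ∈ Set.Icc 0 T, ∀ b ∈ Set.Icc 0 T,
      IntervalIntegrable (Kstate R₀ c w) volume a b := fun w hw a ha b hb =>
    ((continuousOn_Kstate hT.le fun a ha b hb => hw.intervalIntegrable ha hb).mono
      (Set.uIcc_subset_Icc ha hb)).intervalIntegrable
  have hJ : ∀ w, Admissible T u₁ w → Jcost α β c T R₀ w =
      α * ((∫ t in (0:ℝ)..τ, Kstate R₀ c w t) + ∫ t in τ..T, Kstate R₀ c w t) +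
        β * ((∫ t in (0:ℝ)..τ, w t) + ∫ t in τ..T, w t) := by
    intro w hw
    rw [intervalIntegral.integral_add_adjacent_intervals (hKi w hw 0 m0 τ mτ) (hKi w hw τ mτ T mT),
      intervalIntegral.integral_add_adjacent_intervals (hw.intervalIntegrable m0 mτ)
        (hw.intervalIntegrable mτ mT), Jcost,
      intervalIntegral.integral_add ((hKi w hw 0 m0 T mT).const_mul α)
        ((hw.intervalIntegrable m0 mT).const_mul β),
      intervalIntegral.integral_const_mul, intervalIntegral.integral_const_mul]
  have hK_eq : ∫ t in (0:ℝ)..τ, Kstate R₀ c v t = ∫ t in (0:ℝ)..τ, Kstate R₀ c uo t := by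
    refine intervalIntegral.integral_congr fun t ht => ?_
    rw [Set.uIcc_of_le hτ0] at ht
    simp only [Kstate]
    rw [hv_eq 0 t hτ0 ht.2]
    congr 2
    refine intervalIntegral.integral_congr fun s hs => ?_
    rw [Set.uIcc_of_le ht.1] at hs
    simp only [hv_eq s t (hs.2.trans ht.2) ht.2]
  have hK_le : ∫ t in τ..T, Kstate R₀ c v t ≤
      (∫ t in τ..T, Kstate R₀ c uo t) + (T - τ) * ((R₀ + c * T) * m) := by
    have h := intervalIntegral.integral_mono_on hτT.le (hKi v hv τ mτ T mT)
      ((hKi uo huo τ mτ T mT).add (intervalIntegrable_const (c := (R₀ + c * T) * m)))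
      fun t ht => Kstate_le_Kstate_add hR₀ hc.le hm hui hvi hvu ⟨hτ0.trans ht.1, ht.2⟩
    rwa [intervalIntegral.integral_add (hKi uo huo τ mτ T mT) intervalIntegrable_const,
      intervalIntegral.integral_const, smul_eq_mul] at h
  have hm0 : m = 0 := by
    have h := hopt v hv
    rw [hJ uo huo, hJ v hv, hK_eq, hv_eq 0 τ hτ0 le_rfl, hv_zero τ T le_rfl hτT.le, ← hm_def] at h
    have h' := mul_le_mul_of_nonneg_left hK_le hα.le
    refine le_antisymm ?_ hm
    by_contra! hpos
    nlinarith [mul_lt_mul_of_pos_right hτ hpos]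
  have hnonneg : 0 ≤ᵐ[volume.restrict (Set.Ioc τ T)] uo := by
    filter_upwards [ae_restrict_of_ae_restrict_of_subset
      (Set.Ioc_subset_Icc_self.trans (Set.Icc_subset_Icc_left hτ0)) huo.2] with x hx using hx.1
  have hz := (intervalIntegral.integral_eq_zero_iff_of_le_of_nonneg_ae hτT.le hnonneg
    (hui τ mτ T mT)).1 hm0
  exact ae_restrict_of_ae_restrict_of_subset Set.Ioo_subset_Ioc_self hz
end
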